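/- Let p, n ∈ ℤ⁺ with n ≥ 2, let 0 < α ≤ 2 and K > 0, and let 1 ≤ s ≤ p be the sparsity level in the alternative. For any ε ∈ (0,1) there exist constants C₁, C₂ > 0 depending only on α, K and ε such that the test φ_{G,dense} := 1{max_{t∈T} A_t > r} with threshold r = C₁(√(p·log log(8n)) + log log(8n)) satisfies R_{G_{α,K}^⊗}(ρ, φ_{G,dense}) ≤ ε whenever ρ² ≥ C₂(√(p·log log(8n)) + log log(8n)). -/

import Mathlib

open MeasureTheory
open scoped Classical

namespace ChangePoint

noncomputable section

/-- The `i`-th column (0-based) of the data matrix, with out-of-range guard. -/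
def col (p n : ℕ) (X : Fin n → Fin p → ℝ) (i : ℕ) : Fin p → ℝ :=
  if h : i < n then X ⟨i, h⟩ else 0

/-- ℓ₀-"norm": the number of nonzero coordinates. -/
def l0 (p : ℕ) (v : Fin p → ℝ) : ℕ :=
  (Finset.univ.filter fun j : Fin p => v j ≠ 0).card

/-- Squared Euclidean norm on `ℝ^p`. -/
def sqnorm (p : ℕ) (v : Fin p → ℝ) : ℝ := ∑ j, v j ^ 2

/-- The iterated logarithm `log log (8 n)`. -/
def LL (n : ℕ) : ℝ := Real.log (Real.log (8 * n))

/-- The sub-Weibull class `𝒢_{α,K}` of distributions on `ℝ`: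
mean `0`, variance `1` and `𝔼 exp (|W/K|^α) ≤ 2`. -/
def memG (α K : ℝ) (ν : Measure ℝ) : Prop :=
  IsProbabilityMeasure ν ∧ Integrable id ν ∧ (∫ x, x ∂ν) = 0 ∧
    (∫⁻ x, ENNReal.ofReal (x ^ 2) ∂ν) = 1 ∧
    (∫⁻ x, ENNReal.ofReal (Real.exp (|x / K| ^ α)) ∂ν) ≤ 2

/-- The polynomially-tailed class `𝒫_{α,K}` of distributions on `ℝ`:
mean `0`, variance `1` and `𝔼 |W/K|^α ≤ 1`. -/
def memP (α K : ℝ) (ν : Measure ℝ) : Prop :=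
  IsProbabilityMeasure ν ∧ Integrable id ν ∧ (∫ x, x ∂ν) = 0 ∧
    (∫⁻ x, ENNReal.ofReal (x ^ 2) ∂ν) = 1 ∧
    (∫⁻ x, ENNReal.ofReal (|x / K| ^ α) ∂ν) ≤ 1

/-- `P` is the joint law on `ℝ^{p×n}` of `p·n` independent entries with marginal laws `ν t j`
(characterised on measurable rectangles). -/
def IsEntrywiseProduct (p n : ℕ) (P : Measure (Fin n → Fin p → ℝ))
    (ν : Fin n → Fin p → Measure ℝ) : Prop :=
  IsProbabilityMeasure P ∧
    ∀ s : Fin n → Fin p → Set ℝ, (∀ t j, MeasurableSet (s t j)) →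
      P {x | ∀ t j, x t j ∈ s t j} = ∏ t, ∏ j, ν t j (s t j)

/-- The class `𝒢_{α,K}^⊗` of noise distributions. -/
def Gclass (p n : ℕ) (α K : ℝ) : Set (Measure (Fin n → Fin p → ℝ)) :=
  {P | ∃ ν : Fin n → Fin p → Measure ℝ, (∀ t j, memG α K (ν t j)) ∧ IsEntrywiseProduct p n P ν}

/-- The class `𝒫_{α,K}^⊗` of noise distributions. -/
def Pclass (p n : ℕ) (α K : ℝ) : Set (Measure (Fin n → Fin p → ℝ)) :=
  {P | ∃ ν : Fin n → Fin p → Measure ℝ, (∀ t j, memP α K (ν t j)) ∧ IsEntrywiseProduct p n P ν}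

/-- The null parameter space `Θ₀(p,n)`: constant signal. -/
def Theta0 (p n : ℕ) : Set (Fin n → Fin p → ℝ) :=
  {θ | ∃ μ : Fin p → ℝ, ∀ t, θ t = μ}

/-- `Θ^{(t₀)}(p,n,s,ρ)`: a single mean change at (1-based) time `t0` of sparsity `s` and
normalized signal strength at least `ρ`. -/
def ThetaAt (p n t0 s : ℕ) (ρ : ℝ) : Set (Fin n → Fin p → ℝ) :=
  {θ | ∃ μ₁ μ₂ : Fin p → ℝ,
    (∀ t : Fin n, (t : ℕ) < t0 → θ t = μ₁) ∧
    (∀ t : Fin n, t0 ≤ (t : ℕ) → θ t = μ₂) ∧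
    l0 p (fun j => μ₁ j - μ₂ j) ≤ s ∧
    ρ ^ 2 ≤ (t0 : ℝ) * ((n : ℝ) - (t0 : ℝ)) / (n : ℝ) * sqnorm p (fun j => μ₁ j - μ₂ j)}

/-- The single-change-point alternative `Θ(p,n,s,ρ)`. -/
def Theta1 (p n s : ℕ) (ρ : ℝ) : Set (Fin n → Fin p → ℝ) :=
  ⋃ t0 ∈ Finset.Icc 1 (n - 1), ThetaAt p n t0 s ρ

/-- A (randomized-free) test: a measurable `{0,1}`-valued function of the data. -/
def IsTest (p n : ℕ) (φ : (Fin n → Fin p → ℝ) → ℝ) : Prop :=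
  Measurable φ ∧ ∀ x, φ x = 0 ∨ φ x = 1

/-- The worst-case testing error of the test `φ` for null `Θ₀(p,n)` against the
alternative `Θalt`, over the noise class `Q`. -/
def risk (p n : ℕ) (Q : Set (Measure (Fin n → Fin p → ℝ)))
    (Θalt : Set (Fin n → Fin p → ℝ)) (φ : (Fin n → Fin p → ℝ) → ℝ) : ℝ :=
  (⨆ P ∈ Q, ⨆ θ ∈ Theta0 p n, ∫ E, φ (θ + E) ∂P) +
  (⨆ P ∈ Q, ⨆ θ ∈ Θalt, ∫ E, (1 - φ (θ + E)) ∂P)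

/-- The dyadic grid `𝒯 = {1,2,4,…,2^{⌊log₂(n/2)⌋}}`. -/
def Tgrid (n : ℕ) : Finset ℕ :=
  (Finset.range (Nat.log 2 (n / 2) + 1)).image fun k => 2 ^ k

/-- The CUSUM-type statistic `Y_t`. -/
def Yt (p n : ℕ) (X : Fin n → Fin p → ℝ) (t : ℕ) (j : Fin p) : ℝ :=
  (∑ i ∈ Finset.range t, (col p n X i j - col p n X (n - 1 - i) j)) / Real.sqrt (2 * t)

/-- `A_t = ∑_j (Y_t(j)² − 1)`. -/
def At (p n : ℕ) (X : Fin n → Fin p → ℝ) (t : ℕ) : ℝ :=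
  ∑ j, (Yt p n X t j ^ 2 - 1)

/-- The dense sub-Weibull test `φ_{𝒢,dense}` with threshold `r`. -/
def phiGdense (p n : ℕ) (r : ℝ) (X : Fin n → Fin p → ℝ) : ℝ :=
  if ∃ t ∈ Tgrid n, r < At p n X t then 1 else 0

/-- Sample-splitting statistic `Y_{t,1}` (odd-indexed observations). -/
def Yt1 (p n : ℕ) (X : Fin n → Fin p → ℝ) (t : ℕ) (j : Fin p) : ℝ :=
  (∑ i ∈ Finset.range (t / 2), (col p n X (2 * i) j - col p n X (n - 1 - 2 * i) j)) /
    Real.sqrt t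

/-- Sample-splitting statistic `Y_{t,2}` (even-indexed observations). -/
def Yt2 (p n : ℕ) (X : Fin n → Fin p → ℝ) (t : ℕ) (j : Fin p) : ℝ :=
  (∑ i ∈ Finset.range (t / 2), (col p n X (2 * i + 1) j - col p n X (n - 2 - 2 * i) j)) /
    Real.sqrt t

/-- `Y_1 = (X_1 − X_n)/√2`. -/
def Y1 (p n : ℕ) (X : Fin n → Fin p → ℝ) (j : Fin p) : ℝ :=
  (col p n X 0 j - col p n X (n - 1) j) / Real.sqrt 2

/-- The hard-thresholded statistic `A_{t,a}`. -/
def Ata (p n : ℕ) (X : Fin n → Fin p → ℝ) (t : ℕ) (a : ℝ) : ℝ :=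
  if t = 1 then ∑ j, (Y1 p n X j ^ 2 - 1) * (if a ≤ |Y1 p n X j| then 1 else 0)
  else ∑ j, (Yt1 p n X t j ^ 2 - 1) * (if a ≤ |Yt2 p n X t j| then 1 else 0)

/-- The sparse sub-Weibull test `φ_{𝒢,sparse}` with threshold parameters `a, r, r₁`. -/
def phiGsparse (p n : ℕ) (a r r₁ : ℝ) (X : Fin n → Fin p → ℝ) : ℝ :=
  if (∃ t ∈ Tgrid n, t ≠ 1 ∧ r < Ata p n X t a) ∨ r₁ < Ata p n X 1 a then 1 else 0

/-- The median of a list of reals: its `⌈m/2⌉`-th smallest element. -/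
def median (l : List ℝ) : ℝ :=
  (l.insertionSort (· ≤ ·)).getD ((l.length + 1) / 2 - 1) 0

/-- `Z_i = (X_i − X_{n+1−i})/√2` (0-based index `i`). -/
def Zb (p n : ℕ) (X : Fin n → Fin p → ℝ) (i : ℕ) (j : Fin p) : ℝ :=
  (col p n X i j - col p n X (n - 1 - i) j) / Real.sqrt 2

/-- Mean of the `g`-th (0-based) of `G` consecutive equal-size groups of `Z_1,…,Z_t`. -/
def groupMean (p n : ℕ) (X : Fin n → Fin p → ℝ) (t G g : ℕ) (j : Fin p) : ℝ :=
  (∑ i ∈ Finset.range (t / G), Zb p n X (g * (t / G) + i) j) / ((t / G : ℕ) : ℝ)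

/-- The median-of-means statistic `A_t^{MoM}` with `G` groups. -/
def AMoM (p n : ℕ) (X : Fin n → Fin p → ℝ) (t G : ℕ) : ℝ :=
  (t : ℝ) * median (List.ofFn fun g : Fin G =>
    ∑ j, (groupMean p n X t G (g : ℕ) j ^ 2 - (G : ℝ) / (t : ℝ)))

/-- `Δ = 2^{3+⌈log₂ log log (8n)⌉}`. -/
def DeltaDense (n : ℕ) : ℕ := 2 ^ (3 + (Int.ceil (Real.logb 2 (LL n))).toNat)

/-- The dense median-of-means test `φ_{𝒫,dense}`. -/
def phiPdense (p n : ℕ) (α C₁ : ℝ) (X : Fin n → Fin p → ℝ) : ℝ :=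
  if ∃ t ∈ Tgrid n,
      1 < AMoM p n X t (min t (DeltaDense n)) /
        (C₁ * (p : ℝ) ^ max ((1 : ℝ) / 2) (2 / α) * ((min t (DeltaDense n) : ℕ) : ℝ))
  then 1 else 0

/-- `Δ = 2^{4+⌈log₂ log log (8n)⌉}`. -/
def DeltaSparse (n : ℕ) : ℕ := 2 ^ (4 + (Int.ceil (Real.logb 2 (LL n))).toNat)

/-- Mean of the `g`-th (0-based) of `G` consecutive equal-size groups of the odd-indexed
`Z_1, Z_3, …, Z_{t−1}`. -/
def groupMeanOdd (p n : ℕ) (X : Fin n → Fin p → ℝ) (t G g : ℕ) (j : Fin p) : ℝ :=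
  (∑ i ∈ Finset.range (t / (2 * G)), Zb p n X (2 * (g * (t / (2 * G)) + i)) j) /
    ((t / (2 * G) : ℕ) : ℝ)

/-- The hard-thresholded median-of-means statistic `A_{t,a}^{MoM}` with `G` groups. -/
def AMoMa (p n : ℕ) (X : Fin n → Fin p → ℝ) (t G : ℕ) (a : ℝ) : ℝ :=
  if t = 1 then ∑ j, (Zb p n X 0 j ^ 2 - 1) * (if a ≤ |Zb p n X 0 j| then 1 else 0)
  else ((t : ℝ) / 2) * median (List.ofFn fun g : Fin G =>
    ∑ j, (groupMeanOdd p n X t G (g : ℕ) j ^ 2 - 2 * (G : ℝ) / (t : ℝ)) *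
      (if a ≤ |Yt2 p n X t j| then 1 else 0))

/-- The sparse median-of-means test `φ_{𝒫,sparse}^{MoM}`. -/
def phiPsparseMoM (p n s : ℕ) (α C₁ C₂ : ℝ) (X : Fin n → Fin p → ℝ) : ℝ :=
  if ∃ t ∈ Tgrid n,
      1 < AMoMa p n X t (min t (DeltaSparse n) / 2)
            (C₁ * (((p : ℝ) / (s : ℝ)) ^ ((1 : ℝ) / α) +
              ((s : ℝ) ^ (-(1 : ℝ) / 2)) * Real.sqrt (LL n))) /
          (C₂ * (if t = 1 then (s : ℝ) * ((p : ℝ) / (s : ℝ)) ^ ((2 : ℝ) / α)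
                 else Real.sqrt (s : ℝ) * ((min t (DeltaSparse n) / 2 : ℕ) : ℝ)))
  then 1 else 0

/-- Condition RSM for `(α, K)` with constants `C₁, C₂`: statistical guarantee for a family
of (measurable) robust sparse mean estimators. -/
def CondRSM (p s : ℕ) (α K C₁ C₂ : ℝ)
    (est : (m : ℕ) → (Fin m → Fin p → ℝ) → ℝ → Fin p → ℝ) : Prop :=
  (∀ m : ℕ, Measurable fun Wη : (Fin m → Fin p → ℝ) × ℝ => est m Wη.1 Wη.2) ∧
  ∀ (m : ℕ) (μW : Fin p → ℝ) (ν : Fin m → Measure (Fin p → ℝ))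
    (P : Measure (Fin m → Fin p → ℝ)) (η : ℝ),
    0 < η → η < 1 → l0 p μW ≤ s →
    (∀ i, IsProbabilityMeasure (ν i)) →
    (∀ i j, Integrable (fun w => w j) (ν i) ∧ (∫ w, w j ∂ν i) = μW j) →
    (∀ i j k, Integrable (fun w => (w j - μW j) * (w k - μW k)) (ν i) ∧
      (∫ w, (w j - μW j) * (w k - μW k) ∂ν i) = if j = k then 1 else 0) →
    (∀ i j, (∫⁻ w, ENNReal.ofReal (|w j - μW j| ^ α) ∂ν i) ≤
      ENNReal.ofReal ((Real.sqrt 2 * K) ^ α)) →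
    IsProbabilityMeasure P →
    (∀ S : Fin m → Set (Fin p → ℝ), (∀ i, MeasurableSet (S i)) →
      P {W | ∀ i, W i ∈ S i} = ∏ i, ν i (S i)) →
    C₁ * ((s : ℝ) * Real.log (Real.exp 1 * (p : ℝ) / (s : ℝ)) + Real.log (1 / η)) ≤ (m : ℝ) →
    ENNReal.ofReal (1 - η) ≤
      P {W | Real.sqrt (sqnorm p fun j => est m W η j - μW j) ≤
        Real.sqrt C₂ * (Real.sqrt ((s : ℝ) * Real.log (Real.exp 1 * (p : ℝ) / (s : ℝ)) / (m : ℝ)) +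
          Real.sqrt (Real.log (1 / η) / (m : ℝ)))}

/-- `Δ̃₁ = C₅ (s log(ep/s) + log(16/ε))`. -/
def rsmDelta1 (p s : ℕ) (ε C₅ : ℝ) : ℝ :=
  C₅ * ((s : ℝ) * Real.log (Real.exp 1 * (p : ℝ) / (s : ℝ)) + Real.log (16 / ε))

/-- `Δ̃₂ = C₅ (s log(ep/s) + log(16 log(2n)/ε))`. -/
def rsmDelta2 (p s n : ℕ) (ε C₅ : ℝ) : ℝ :=
  C₅ * ((s : ℝ) * Real.log (Real.exp 1 * (p : ℝ) / (s : ℝ)) +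
    Real.log (16 * Real.log (2 * (n : ℝ)) / ε))

/-- `a = C₃ ((p/s)^{1/α} + s^{−1/2} log^{1/2}(log Δ̃₁))`. -/
def rsmA (p s : ℕ) (α ε C₃ C₅ : ℝ) : ℝ :=
  C₃ * (((p : ℝ) / (s : ℝ)) ^ ((1 : ℝ) / α) +
    ((s : ℝ) ^ (-(1 : ℝ) / 2)) * Real.sqrt (Real.log (Real.log (rsmDelta1 p s ε C₅))))

/-- The sparse test `φ^{RSM}_{𝒫,sparse}` built from a robust sparse mean estimator `est`. -/
def phiRSM (p n s : ℕ) (est : (m : ℕ) → (Fin m → Fin p → ℝ) → ℝ → Fin p → ℝ)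
    (α ε C₃ C₄ C₅ C₆ : ℝ) (X : Fin n → Fin p → ℝ) : ℝ :=
  if (∃ t ∈ Tgrid n, (t : ℝ) ≤ rsmDelta1 p s ε C₅ ∧
        1 < Ata p n X t (rsmA p s α ε C₃ C₅) /
          (C₄ * (if t = 1 then (s : ℝ) * ((p : ℝ) / (s : ℝ)) ^ ((2 : ℝ) / α)
                 else Real.sqrt ((s : ℝ) * Real.log (rsmDelta1 p s ε C₅))))) ∨
     (∃ t ∈ Tgrid n, rsmDelta1 p s ε C₅ < (t : ℝ) ∧
        1 < (t : ℝ) * sqnorm p (est t (fun i : Fin t => fun j => Zb p n X (i : ℕ) j)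
              (Real.exp ((s : ℝ) * Real.log (Real.exp 1 * (p : ℝ) / (s : ℝ)) -
                min (t : ℝ) (rsmDelta2 p s n ε C₅) / C₅))) /
          (C₆ * min (t : ℝ) (rsmDelta2 p s n ε C₅)))
  then 1 else 0

/-- The multiple-change-point alternative `Θ_multi(p,n,ρ)`. -/
def ThetaMulti (p n : ℕ) (ρ : ℝ) : Set (Fin n → Fin p → ℝ) :=
  {θ | ∃ k : ℕ, 1 ≤ k ∧ ∃ τ : ℕ → ℕ, ∃ μ : ℕ → Fin p → ℝ,
    τ 0 = 0 ∧ τ (k + 1) = n ∧ (∀ i ≤ k, τ i < τ (i + 1)) ∧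
    (∀ i, 1 ≤ i → i ≤ k + 1 →
      ∀ t : Fin n, τ (i - 1) ≤ (t : ℕ) → (t : ℕ) < τ i → θ t = μ i) ∧
    ∃ i, 1 ≤ i ∧ i ≤ k ∧
      4 * Real.log (n : ℝ) ≤ ((min (τ i - τ (i - 1)) (τ (i + 1) - τ i) : ℕ) : ℝ) ∧
      ρ ^ 2 ≤ sqnorm p (fun j => μ (i + 1) j - μ i j) *
        ((min (τ i - τ (i - 1)) (τ (i + 1) - τ i) : ℕ) : ℝ)}

/-- Membership in the temporal-dependence class `𝒫_Temp`: independent rows, entrywise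
`𝒫_{α,K}` marginals, and exponentially decaying interlaced α-mixing coefficients. -/
def memPTemp (p n : ℕ) (α K c₁ c₂ : ℝ) (P : Measure (Fin n → Fin p → ℝ)) : Prop :=
  IsProbabilityMeasure P ∧
  (∀ s : Fin p → Set (Fin n → ℝ), (∀ j, MeasurableSet (s j)) →
    P {x | ∀ j, (fun t => x t j) ∈ s j} = ∏ j, P {x | (fun t => x t j) ∈ s j}) ∧
  (∀ t j, memP α K (P.map fun x => x t j)) ∧
  (∀ i : ℕ, 1 ≤ i → i ≤ n - 1 →
    ∀ S T : Set (Fin n),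
      (∀ s' ∈ S, ∀ t' ∈ T, (i : ℤ) ≤ |((s' : ℕ) : ℤ) - ((t' : ℕ) : ℤ)|) →
      ∀ A B : Set (Fin n → Fin p → ℝ),
        MeasurableSet[MeasurableSpace.comap (fun x (t : S) => x t.1) inferInstance] A →
        MeasurableSet[MeasurableSpace.comap (fun x (t : T) => x t.1) inferInstance] B →
        |(P (A ∩ B)).toReal - (P A).toReal * (P B).toReal| ≤ c₁ * Real.exp (-c₂ * (i : ℝ)))

/-- The class `𝒲_α` of distributions on `ℝ^p`: centered with `𝔼|⟨W,v⟩|^α ≤ 1` for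
every unit vector `v`. -/
def memW (p : ℕ) (α : ℝ) (ν : Measure (Fin p → ℝ)) : Prop :=
  IsProbabilityMeasure ν ∧
  (∀ j, Integrable (fun w => w j) ν ∧ (∫ w, w j ∂ν) = 0) ∧
  ∀ v : Fin p → ℝ, sqnorm p v = 1 →
    (∫⁻ w, ENNReal.ofReal (|∑ j, w j * v j| ^ α) ∂ν) ≤ 1

/-- The class `𝒲_α^⊗`: independent columns with distributions in `𝒲_α`. -/
def Wclass (p n : ℕ) (α : ℝ) : Set (Measure (Fin n → Fin p → ℝ)) :=
  {P | ∃ ν : Fin n → Measure (Fin p → ℝ), (∀ t, memW p α (ν t)) ∧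
    IsProbabilityMeasure P ∧
    ∀ s : Fin n → Set (Fin p → ℝ), (∀ t, MeasurableSet (s t)) →
      P {x | ∀ t, x t ∈ s t} = ∏ t, ν t (s t)}

/-- The alternative `⋃_{t₀=1}^{n−1} Θ(p,n,ρ_{t₀})` for a location-dependent signal
strength sequence `ρ`. -/
def ThetaSeq (p n : ℕ) (ρ : ℕ → ℝ) : Set (Fin n → Fin p → ℝ) :=
  ⋃ t0 ∈ Finset.Icc 1 (n - 1),
    {θ | ∃ μ₁ μ₂ : Fin p → ℝ,
      (∀ t : Fin n, (t : ℕ) < t0 → θ t = μ₁) ∧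
      (∀ t : Fin n, t0 ≤ (t : ℕ) → θ t = μ₂) ∧
      (ρ t0) ^ 2 ≤ sqnorm p (fun j => μ₁ j - μ₂ j)}

/-- The boundary-restricted alternative `Θ_res(p,n,s,ρ)`. -/
def ThetaRes (p n s : ℕ) (ρ tres : ℝ) : Set (Fin n → Fin p → ℝ) :=
  {θ | ∃ t0 : ℕ, tres + 1 ≤ (t0 : ℝ) ∧ (t0 : ℝ) ≤ (n : ℝ) - tres ∧ θ ∈ ThetaAt p n t0 s ρ}

/-- `t^res = 32 (log (e² p / s) + s^{−1} log log (8n))`. -/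
def tRes (p n s : ℕ) : ℝ :=
  32 * (Real.log (Real.exp 1 ^ 2 * (p : ℝ) / (s : ℝ)) + LL n / (s : ℝ))

end

/-- `f` is measurable and has finite absolute moments of every natural order. -/
def HasAllMoments {Ω : Type*} [MeasurableSpace Ω] (μ : Measure Ω) (f : Ω → ℝ) : Prop :=
  Measurable f ∧ ∀ q : ℕ, Integrable (fun ω => |f ω| ^ q) μ

namespace HasAllMoments

variable {Ω : Type*} [MeasurableSpace Ω] {μ : Measure Ω}

lemma integrable_pow {f : Ω → ℝ} (hf : HasAllMoments μ f) (q : ℕ) :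
    Integrable (fun ω => f ω ^ q) μ :=
  (hf.2 q).mono' (hf.1.pow_const q).aestronglyMeasurable
    (Filter.Eventually.of_forall fun ω => by simp)

lemma integrable {f : Ω → ℝ} (hf : HasAllMoments μ f) : Integrable f μ := by
  simpa using hf.integrable_pow 1

lemma const [IsFiniteMeasure μ] (c : ℝ) : HasAllMoments μ (fun _ => c) :=
  ⟨measurable_const, fun _ => integrable_const _⟩

lemma add {f g : Ω → ℝ} (hf : HasAllMoments μ f) (hg : HasAllMoments μ g) :
    HasAllMoments μ (fun ω => f ω + g ω) := by
  refine ⟨hf.1.add hg.1, fun q => ?_⟩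
  refine (((hf.2 q).add (hg.2 q)).const_mul (2 ^ q)).mono'
    ((hf.1.add hg.1).abs.pow_const q).aestronglyMeasurable
    (Filter.Eventually.of_forall fun ω => ?_)
  rw [Real.norm_of_nonneg (by positivity)]
  have h1 : |f ω + g ω| ≤ 2 * max |f ω| |g ω| := by
    have := abs_add_le (f ω) (g ω)
    linarith [le_max_left |f ω| |g ω|, le_max_right |f ω| |g ω|]
  have hm : (max |f ω| |g ω|) ^ q ≤ |f ω| ^ q + |g ω| ^ q := by
    rcases max_cases |f ω| |g ω| with h | h <;> rw [h.1] <;>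
      linarith [pow_nonneg (abs_nonneg (f ω)) q, pow_nonneg (abs_nonneg (g ω)) q]
  calc |f ω + g ω| ^ q ≤ (2 * max |f ω| |g ω|) ^ q := by gcongr
    _ = 2 ^ q * (max |f ω| |g ω|) ^ q := mul_pow _ _ _
    _ ≤ _ := by simpa using mul_le_mul_of_nonneg_left hm (by positivity : (0 : ℝ) ≤ 2 ^ q)

lemma mul {f g : Ω → ℝ} (hf : HasAllMoments μ f) (hg : HasAllMoments μ g) :
    HasAllMoments μ (fun ω => f ω * g ω) := by
  refine ⟨hf.1.mul hg.1, fun q => ?_⟩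
  refine ((hf.2 (q * 2)).add (hg.2 (q * 2))).mono'
    ((hf.1.mul hg.1).abs.pow_const q).aestronglyMeasurable
    (Filter.Eventually.of_forall fun ω => ?_)
  rw [Real.norm_of_nonneg (by positivity)]
  simp only [Pi.add_apply, abs_mul, mul_pow, pow_mul]
  nlinarith [sq_nonneg (|f ω| ^ q - |g ω| ^ q), pow_nonneg (abs_nonneg (f ω)) q,
    pow_nonneg (abs_nonneg (g ω)) q]

lemma const_mul [IsFiniteMeasure μ] {f : Ω → ℝ} (c : ℝ) (hf : HasAllMoments μ f) :
    HasAllMoments μ (fun ω => c * f ω) :=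
  (HasAllMoments.const c).mul hf

lemma sq {f : Ω → ℝ} (hf : HasAllMoments μ f) : HasAllMoments μ (fun ω => f ω ^ 2) := by
  simpa only [pow_two] using hf.mul hf

lemma sum [IsFiniteMeasure μ] {ι : Type*} {X : ι → Ω → ℝ} (h : ∀ i, HasAllMoments μ (X i))
    (s : Finset ι) : HasAllMoments μ (fun ω => ∑ i ∈ s, X i ω) := by
  induction s using Finset.induction_on with
  | empty => simpa using HasAllMoments.const (μ := μ) 0
  | insert a s ha ih => simpa only [Finset.sum_insert ha] using (h a).add ih

end HasAllMoments

/-- The weighted Taylor terms of a Bernstein-type moment condition sum to at most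
`1 + 2 v l²`. -/
lemma sum_bernstein_le {v l : ℝ} (hv : 0 ≤ v) (m : ℕ) :
    ∑ i ∈ Finset.range m, (if i = 0 then 1 else if i = 1 then 0
      else v * l ^ 2 * (1 / 2 : ℝ) ^ (i - 2)) ≤ 1 + 2 * v * l ^ 2 := by
  have key : ∀ k : ℕ, ∑ i ∈ Finset.range k, v * l ^ 2 * (1 / 2 : ℝ) ^ i ≤ 2 * v * l ^ 2 := by
    intro k
    rw [← Finset.mul_sum]
    have : ∑ i ∈ Finset.range k, (1 / 2 : ℝ) ^ i ≤ 2 := by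
      simpa using sum_geometric_two_le k
    have h2 := mul_le_mul_of_nonneg_left this (by positivity : 0 ≤ v * l ^ 2)
    linarith
  have hpos : 0 ≤ v * l ^ 2 := by positivity
  match m with
  | 0 => simp; nlinarith
  | 1 => simp; nlinarith
  | k + 2 =>
    rw [Finset.sum_range_succ', Finset.sum_range_succ']
    have := key k
    simp only [show ∀ i : ℕ, i + 1 + 1 ≠ 0 from fun i => by omega,
      show ∀ i : ℕ, i + 1 + 1 ≠ 1 from fun i => by omega, if_false,
      show ∀ i : ℕ, i + 1 + 1 - 2 = i from fun i => by omega]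
    simpa [add_comm] using this

/-- Bernstein-type bound for the moments of a sum of centred random variables whose partial
sums are independent of the next summand, under a Bernstein moment condition up to order `N`. -/
lemma abs_moment_sum_le {Ω ι : Type*} [MeasurableSpace Ω] {μ : Measure Ω}
    [IsProbabilityMeasure μ] {X : ι → Ω → ℝ} (hX : ∀ i, HasAllMoments μ (X i))
    (hind : ∀ (s : Finset ι) (i : ι), i ∉ s →
      ProbabilityTheory.IndepFun (fun ω => ∑ j ∈ s, X j ω) (X i) μ)
    (h0 : ∀ i, ∫ ω, X i ω ∂μ = 0) {N : ℕ} {v : ι → ℝ} {H l : ℝ} (hv : ∀ i, 0 ≤ v i)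
    (hH : 0 ≤ H) (hl : 0 < l) (hlH : l * H ≤ 1 / 2)
    (hmom : ∀ i (m : ℕ), 2 ≤ m → m ≤ N →
      |∫ ω, X i ω ^ m ∂μ| ≤ m.factorial * v i * H ^ (m - 2))
    (s : Finset ι) : ∀ m ≤ N,
    |∫ ω, (∑ i ∈ s, X i ω) ^ m ∂μ| ≤
      m.factorial * (l ^ m)⁻¹ * Real.exp (2 * l ^ 2 * ∑ i ∈ s, v i) := by
  induction s using Finset.induction_on with
  | empty =>
    intro m _
    rcases Nat.eq_zero_or_pos m with rfl | hm
    · simp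
    · simp [zero_pow hm.ne']
      positivity
  | insert a s ha ih =>
    intro m hm
    set S : Ω → ℝ := fun ω => ∑ j ∈ s, X j ω with hS
    have hSm : HasAllMoments μ S := HasAllMoments.sum hX s
    set V := ∑ i ∈ s, v i with hV
    have hexpand : ∫ ω, (∑ i ∈ insert a s, X i ω) ^ m ∂μ =
        ∑ k ∈ Finset.range (m + 1), (∫ ω, X a ω ^ k ∂μ) * (∫ ω, S ω ^ (m - k) ∂μ) *
          (m.choose k : ℝ) := by
      have hi : ∀ k : ℕ, ProbabilityTheory.IndepFun (fun ω => X a ω ^ k)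
          (fun ω => S ω ^ (m - k)) μ := fun k =>
        ((hind s a ha).symm).comp (φ := fun x => x ^ k) (ψ := fun x => x ^ (m - k))
          (measurable_id.pow_const k) (measurable_id.pow_const (m - k))
      simp only [Finset.sum_insert ha]
      simp_rw [add_pow]
      rw [integral_finsetSum]
      · refine Finset.sum_congr rfl fun k _ => ?_
        rw [integral_mul_const]
        congr 1
        exact (hi k).integral_mul_eq_mul_integral
          ((hX a).integrable_pow k).aestronglyMeasurable
          (hSm.integrable_pow (m - k)).aestronglyMeasurable
      · intro k _
        exact ((hi k).integrable_mul ((hX a).integrable_pow k)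
          (hSm.integrable_pow (m - k))).mul_const _
    rw [hexpand]
    have hterm : ∀ k ∈ Finset.range (m + 1),
        |(∫ ω, X a ω ^ k ∂μ) * (∫ ω, S ω ^ (m - k) ∂μ) * (m.choose k : ℝ)| ≤
        (m.factorial * (l ^ m)⁻¹ * Real.exp (2 * l ^ 2 * V)) *
        (if k = 0 then 1 else if k = 1 then 0
          else v a * l ^ 2 * (1 / 2 : ℝ) ^ (k - 2)) := by
      intro k hk
      have hkm : k ≤ m := by simpa [Nat.lt_succ_iff] using hk
      have hSk := ih (m - k) (by omega)
      rcases Nat.eq_zero_or_pos k with rfl | hk0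
      · simpa using hSk
      rcases Nat.eq_or_lt_of_le (Nat.succ_le_of_lt hk0) with h1 | h2
      · have h1' : k = 1 := h1.symm
        subst h1'
        simp [h0 a]
      · have hk2 : 2 ≤ k := h2
        rw [if_neg (by omega), if_neg (by omega), abs_mul, abs_mul, Nat.abs_cast]
        have hXk := hmom a k hk2 (by omega)
        have hfac : (m.choose k : ℝ) * k.factorial * (m - k).factorial = m.factorial := by
          exact_mod_cast Nat.choose_mul_factorial_mul_factorial hkm
        have hpow : H ^ (k - 2) ≤ (l ^ (k - 2))⁻¹ * (1 / 2 : ℝ) ^ (k - 2) := by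
          rw [inv_mul_eq_div, le_div_iff₀ (by positivity), mul_comm, ← mul_pow]
          gcongr
        have hva := hv a
        calc |∫ ω, X a ω ^ k ∂μ| * |∫ ω, S ω ^ (m - k) ∂μ| * (m.choose k : ℝ)
            ≤ (k.factorial * v a * ((l ^ (k - 2))⁻¹ * (1 / 2 : ℝ) ^ (k - 2))) *
              ((m - k).factorial * (l ^ (m - k))⁻¹ * Real.exp (2 * l ^ 2 * V)) *
              (m.choose k : ℝ) := by
              gcongr
              exact hXk.trans (by gcongr)
          _ = ((m.choose k : ℝ) * k.factorial * (m - k).factorial) *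
              ((l ^ (k - 2))⁻¹ * (l ^ (m - k))⁻¹) * Real.exp (2 * l ^ 2 * V) *
              (v a * (1 / 2 : ℝ) ^ (k - 2)) := by ring
          _ = _ := by
              have : (l ^ (k - 2))⁻¹ * (l ^ (m - k))⁻¹ = (l ^ m)⁻¹ * l ^ 2 := by
                rw [← mul_inv, ← pow_add, show k - 2 + (m - k) = m - 2 by omega]
                have : l ^ m = l ^ (m - 2) * l ^ 2 := by
                  rw [← pow_add, Nat.sub_add_cancel (by omega)]
                rw [this]
                field_simp
              rw [hfac, this]
              ring
    calc _ ≤ _ := Finset.abs_sum_le_sum_abs _ _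
      _ ≤ _ := Finset.sum_le_sum hterm
      _ = (m.factorial * (l ^ m)⁻¹ * Real.exp (2 * l ^ 2 * V)) * _ := by
          rw [← Finset.mul_sum]
      _ ≤ (m.factorial * (l ^ m)⁻¹ * Real.exp (2 * l ^ 2 * V)) *
          Real.exp (2 * l ^ 2 * v a) := by
          gcongr
          refine (sum_bernstein_le (hv a) (m + 1)).trans ?_
          have := Real.add_one_le_exp (2 * l ^ 2 * v a)
          linarith
      _ = _ := by
          rw [mul_assoc, ← Real.exp_add, Finset.sum_insert ha, mul_add, add_comm, ← hV]

/-- The second moment of a sum of centred random variables whose partial sums are independent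
of the next summand. -/
lemma integral_sq_sum_eq {Ω ι : Type*} [MeasurableSpace Ω] {μ : Measure Ω}
    [IsProbabilityMeasure μ] {X : ι → Ω → ℝ} (hX : ∀ i, HasAllMoments μ (X i))
    (hind : ∀ (s : Finset ι) (i : ι), i ∉ s →
      ProbabilityTheory.IndepFun (fun ω => ∑ j ∈ s, X j ω) (X i) μ)
    (h0 : ∀ i, ∫ ω, X i ω ∂μ = 0) (s : Finset ι) :
    ∫ ω, (∑ i ∈ s, X i ω) ^ 2 ∂μ = ∑ i ∈ s, ∫ ω, X i ω ^ 2 ∂μ := by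
  induction s using Finset.induction_on with
  | empty => simp
  | insert a s ha ih =>
    have hSm : HasAllMoments μ (fun ω => ∑ j ∈ s, X j ω) := HasAllMoments.sum hX s
    have hprod : ∫ ω, X a ω * ∑ j ∈ s, X j ω ∂μ = 0 := by
      have := (hind s a ha).symm.integral_mul_eq_mul_integral
        (hX a).integrable.aestronglyMeasurable hSm.integrable.aestronglyMeasurable
      simpa [h0 a] using this
    simp only [Finset.sum_insert ha, ← ih]
    have hexp : ∀ ω, (X a ω + ∑ j ∈ s, X j ω) ^ 2 =
        X a ω ^ 2 + 2 * (X a ω * ∑ j ∈ s, X j ω) + (∑ j ∈ s, X j ω) ^ 2 := fun ω => by ring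
    simp_rw [hexp]
    have hi := ((hX a).mul hSm).integrable
    have hadd : Integrable (fun ω => X a ω ^ 2 + 2 * (X a ω * ∑ j ∈ s, X j ω)) μ :=
      ((hX a).integrable_pow 2).add (hi.const_mul 2)
    rw [integral_add hadd (hSm.integrable_pow 2),
      integral_add ((hX a).integrable_pow 2) (hi.const_mul 2), integral_const_mul, hprod]
    simp

/-- The Bernstein scale of a sub-Weibull law for moments up to order `N`, where `d` is an
integer upper bound for `1 / α`. -/
def weibullScale (K : ℝ) (d N : ℕ) : ℝ := (3 * max 1 K * ((d : ℝ) * N) ^ d) ^ 3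

lemma abs_pow_le_exp_rpow {α K : ℝ} (hK : 0 < K) {d : ℕ} (hd : 1 ≤ α * d)
    (i : ℕ) (x : ℝ) :
    |x| ^ i ≤ K ^ i * (1 + (d * i).factorial * Real.exp (|x / K| ^ α)) := by
  set y := |x / K| with hy
  have hy0 : 0 ≤ y := abs_nonneg _
  have hxy : |x| = K * y := by
    rw [hy, abs_div, abs_of_pos hK]; field_simp
  rw [hxy, mul_pow]
  refine mul_le_mul_of_nonneg_left ?_ (by positivity)
  have hnn : 0 ≤ ((d * i).factorial : ℝ) * Real.exp (y ^ α) := by positivity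
  rcases le_total y 1 with h1 | h1
  · have := pow_le_one₀ (n := i) hy0 h1
    linarith
  · have hyu : y ≤ (y ^ α) ^ d := by
      rw [← Real.rpow_mul_natCast hy0]
      simpa using Real.rpow_le_rpow_of_exponent_le h1 hd
    have h2 : y ^ i ≤ (y ^ α) ^ (d * i) := by
      rw [pow_mul]; gcongr
    have h3 := Real.pow_div_factorial_le_exp (y ^ α) (by positivity) (d * i)
    rw [div_le_iff₀ (by positivity)] at h3
    linarith

lemma memG.integrable_exp {α K : ℝ} {ν : Measure ℝ} (h : memG α K ν) :
    Integrable (fun x => Real.exp (|x / K| ^ α)) ν ∧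
      ∫ x, Real.exp (|x / K| ^ α) ∂ν ≤ 2 := by
  obtain ⟨_, _, _, _, h5⟩ := h
  have hm : Measurable fun x : ℝ => Real.exp (|x / K| ^ α) := by fun_prop
  refine ⟨⟨hm.aestronglyMeasurable, ?_⟩, ?_⟩
  · rw [hasFiniteIntegral_iff_ofReal (Filter.Eventually.of_forall fun x => (Real.exp_pos _).le)]
    exact lt_of_le_of_lt h5 (by simp)
  · rw [integral_eq_lintegral_of_nonneg_ae
      (Filter.Eventually.of_forall fun x => (Real.exp_pos _).le) hm.aestronglyMeasurable]
    exact ENNReal.toReal_le_of_le_ofReal (by norm_num) (by simpa using h5)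

lemma memG.hasAllMoments {α K : ℝ} {ν : Measure ℝ} (h : memG α K ν) (hK : 0 < K)
    {d : ℕ} (hd : 1 ≤ α * d) : HasAllMoments ν (fun x => x) := by
  have := h.1
  refine ⟨measurable_id, fun q => ?_⟩
  refine (((integrable_const (1 : ℝ)).add (h.integrable_exp.1.const_mul
    ((d * q).factorial : ℝ))).const_mul (K ^ q)).mono'
    (by fun_prop) (Filter.Eventually.of_forall fun x => ?_)
  rw [Real.norm_of_nonneg (by positivity)]
  exact abs_pow_le_exp_rpow hK hd q x

lemma memG.integral_sq {α K : ℝ} {ν : Measure ℝ} (h : memG α K ν) : ∫ x, x ^ 2 ∂ν = 1 := by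
  rw [integral_eq_lintegral_of_nonneg_ae (Filter.Eventually.of_forall fun x => sq_nonneg x)
    (by fun_prop), h.2.2.2.1]
  simp

lemma memG.integral_abs_pow_le {α K : ℝ} {ν : Measure ℝ} (h : memG α K ν)
    (hK : 0 < K) {d : ℕ} (hd : 1 ≤ α * d) {m N : ℕ} (hm : 2 ≤ m) (hN : m ≤ N) :
    ∫ x, |x| ^ m ∂ν ≤ m.factorial * weibullScale K d N ^ (m - 2) := by
  have := h.1
  have hd1 : 1 ≤ d := by
    rcases Nat.eq_zero_or_pos d with rfl | h'
    · norm_num at hd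
    · exact h'
  set L₀ : ℝ := 3 * max 1 K * ((d : ℝ) * N) ^ d with hL₀
  have hdN : (1 : ℝ) ≤ (d : ℝ) * N := by
    exact_mod_cast Nat.mul_pos hd1 (by omega : 0 < N)
  have hK1 : 1 ≤ max 1 K := le_max_left _ _
  have hL1 : 1 ≤ L₀ := by
    have h1 : (1 : ℝ) ≤ ((d : ℝ) * N) ^ d := one_le_pow₀ hdN
    have h2 : (1 : ℝ) ≤ 3 * max 1 K := by linarith
    exact one_le_mul_of_one_le_of_one_le h2 h1
  have hf1 : (1 : ℝ) ≤ m.factorial := by exact_mod_cast Nat.factorial_pos m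
  rcases Nat.eq_or_lt_of_le hm with h2 | h3
  · subst h2
    simp [h.integral_sq]
  · have hexp := h.integrable_exp
    have hfac1 : (1 : ℝ) ≤ (d * m).factorial := by exact_mod_cast Nat.factorial_pos _
    have hintegral : ∫ x, |x| ^ m ∂ν ≤ K ^ m * (1 + (d * m).factorial * 2) := by
      calc ∫ x, |x| ^ m ∂ν
          ≤ ∫ x, K ^ m * (1 + (d * m).factorial * Real.exp (|x / K| ^ α)) ∂ν :=
            integral_mono ((h.hasAllMoments hK hd).2 m)
              (((integrable_const (1 : ℝ)).add (hexp.1.const_mul _)).const_mul _)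
              fun x => abs_pow_le_exp_rpow hK hd m x
        _ = K ^ m * (1 + (d * m).factorial * ∫ x, Real.exp (|x / K| ^ α) ∂ν) := by
            rw [integral_const_mul, integral_add (integrable_const _) (hexp.1.const_mul _),
              integral_const_mul]
            simp
        _ ≤ _ := by
            gcongr
            exact hexp.2
    have hfac : ((d * m).factorial : ℝ) ≤ (((d : ℝ) * N) ^ d) ^ m := by
      rw [← pow_mul]
      calc ((d * m).factorial : ℝ) ≤ ((d * m : ℕ) : ℝ) ^ (d * m) := by
            exact_mod_cast Nat.factorial_le_pow _
        _ ≤ _ := by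
            push_cast
            gcongr
    have h3m : (3 : ℝ) ≤ 3 ^ m := by
      calc (3 : ℝ) = 3 ^ 1 := by norm_num
        _ ≤ 3 ^ m := pow_le_pow_right₀ (by norm_num) (by omega)
    calc ∫ x, |x| ^ m ∂ν ≤ K ^ m * (1 + (d * m).factorial * 2) := hintegral
      _ ≤ K ^ m * (3 * (d * m).factorial) := by gcongr; linarith
      _ ≤ (max 1 K) ^ m * (3 ^ m * (((d : ℝ) * N) ^ d) ^ m) := by
          gcongr
          exact le_max_right _ _
      _ = L₀ ^ m := by rw [hL₀, mul_pow, mul_pow]; ring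
      _ ≤ L₀ ^ (3 * (m - 2)) := pow_le_pow_right₀ hL1 (by omega)
      _ = 1 * weibullScale K d N ^ (m - 2) := by rw [pow_mul, weibullScale, one_mul]
      _ ≤ _ := by
          gcongr
          rw [weibullScale]; positivity

/-- Independent centred entries of unit variance satisfying a Bernstein moment condition with
scale `L N` for the moments up to order `N`. -/
structure IsBernsteinNoise (p n : ℕ) (P : Measure (Fin n → Fin p → ℝ)) (L : ℕ → ℝ) : Prop where
  isProb : IsProbabilityMeasure P
  scale_nonneg : ∀ N, 0 ≤ L N
  indep : ProbabilityTheory.iIndepFun (fun (a : Fin n × Fin p) E => E a.1 a.2) P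
  moments : ∀ t j, HasAllMoments P (fun E => E t j)
  mean : ∀ t j, ∫ E, E t j ∂P = 0
  var : ∀ t j, ∫ E, E t j ^ 2 ∂P = 1
  bernstein : ∀ t j (m N : ℕ), 2 ≤ m → m ≤ N →
    ∫ E, |E t j| ^ m ∂P ≤ m.factorial * L N ^ (m - 2)

lemma IsEntrywiseProduct.map_eval {p n : ℕ} {P : Measure (Fin n → Fin p → ℝ)}
    {ν : Fin n → Fin p → Measure ℝ} (hν : ∀ t j, IsProbabilityMeasure (ν t j))
    (h : IsEntrywiseProduct p n P ν) (t : Fin n) (j : Fin p) :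
    P.map (fun E => E t j) = ν t j := by
  ext s hs
  rw [Measure.map_apply (by fun_prop) hs]
  have := h.2 (fun t' j' => if t' = t ∧ j' = j then s else Set.univ)
    (fun t' j' => by split_ifs <;> simp [hs])
  have hset : {x : Fin n → Fin p → ℝ | ∀ t' j', x t' j' ∈
      (if t' = t ∧ j' = j then s else Set.univ)} = (fun E => E t j) ⁻¹' s := by
    ext x
    simp only [Set.mem_ofPred_eq, Set.mem_preimage]
    refine ⟨fun hx => by simpa using hx t j, fun hx t' j' => ?_⟩
    split_ifs with hc
    · rw [hc.1, hc.2]; exact hx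
    · trivial
  rw [hset] at this
  rw [this, Finset.prod_eq_single t, Finset.prod_eq_single j]
  · simp
  · intro j' _ hj'
    simp [hj']
  · simp
  · intro t' _ ht'
    exact Finset.prod_eq_one fun j' _ => by simp [ht']
  · simp

lemma IsEntrywiseProduct.iIndepFun {p n : ℕ} {P : Measure (Fin n → Fin p → ℝ)}
    {ν : Fin n → Fin p → Measure ℝ} (hν : ∀ t j, IsProbabilityMeasure (ν t j))
    (h : IsEntrywiseProduct p n P ν) :
    ProbabilityTheory.iIndepFun (fun (a : Fin n × Fin p) E => E a.1 a.2) P := by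
  rw [ProbabilityTheory.iIndepFun_iff_measure_inter_preimage_eq_mul]
  intro S sets hsets
  have := h.2 (fun t j => if (t, j) ∈ S then sets (t, j) else Set.univ)
    (fun t j => by split_ifs with hc; exacts [hsets _ hc, MeasurableSet.univ])
  have hset : {x : Fin n → Fin p → ℝ | ∀ t j, x t j ∈
      (if (t, j) ∈ S then sets (t, j) else Set.univ)} =
      ⋂ a ∈ S, (fun E : Fin n → Fin p → ℝ => E a.1 a.2) ⁻¹' sets a := by
    ext x
    simp only [Set.mem_ofPred_eq, Set.mem_iInter, Set.mem_preimage]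
    refine ⟨fun hx a ha => by simpa [ha] using hx a.1 a.2, fun hx t j => ?_⟩
    split_ifs with hc
    · exact hx _ hc
    · trivial
  rw [hset] at this
  rw [this, ← Finset.prod_product', Finset.univ_product_univ,
    ← Finset.prod_subset (Finset.subset_univ S)]
  · refine Finset.prod_congr rfl fun a ha => ?_
    rw [if_pos ha, ← h.map_eval hν a.1 a.2, Measure.map_apply (by fun_prop) (hsets a ha)]
  · intro a _ ha
    simp [ha]

lemma isBernsteinNoise_of_mem_Gclass {p n : ℕ} {α K : ℝ} {P : Measure (Fin n → Fin p → ℝ)}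
    (hP : P ∈ Gclass p n α K) (hK : 0 < K) {d : ℕ} (hd : 1 ≤ α * d) :
    IsBernsteinNoise p n P (weibullScale K d) := by
  obtain ⟨ν, hν, hprod⟩ := hP
  have hmap := fun t j => hprod.map_eval (fun t j => (hν t j).1) t j
  have hintegral : ∀ (t : Fin n) (j : Fin p) (f : ℝ → ℝ), Measurable f →
      ∫ E, f (E t j) ∂P = ∫ x, f x ∂(ν t j) := fun t j f hf => by
    have hm : Measurable fun E : Fin n → Fin p → ℝ => E t j := by fun_prop
    rw [← hmap t j, integral_map hm.aemeasurable hf.aestronglyMeasurable]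
  refine ⟨hprod.1, fun N => by rw [weibullScale]; positivity,
    hprod.iIndepFun fun t j => (hν t j).1, fun t j => ⟨by fun_prop, fun q => ?_⟩,
    fun t j => ?_, fun t j => ?_, fun t j m N hm hN => ?_⟩
  · have h1 := ((hν t j).hasAllMoments hK hd).2 q
    rw [← hmap t j] at h1
    exact h1.comp_measurable (by fun_prop)
  · exact (hintegral t j (fun x => x) measurable_id).trans (hν t j).2.2.1
  · rw [hintegral t j (fun x => x ^ 2) (by fun_prop)]
    exact (hν t j).integral_sq
  · rw [hintegral t j (fun x => |x| ^ m) (by fun_prop)]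
    exact (hν t j).integral_abs_pow_le hK hd hm hN

/-- The contrast `∑ i, c i * E i j` of the `j`-th coordinate. -/
def contrast {p n : ℕ} (c : Fin n → ℝ) (j : Fin p) (E : Fin n → Fin p → ℝ) : ℝ :=
  ∑ i, c i * E i j

namespace IsBernsteinNoise

variable {p n : ℕ} {P : Measure (Fin n → Fin p → ℝ)} {L : ℕ → ℝ}

lemma indepFun_partial_sum (h : IsBernsteinNoise p n P L) (c : Fin n → ℝ) (j : Fin p)
    (s : Finset (Fin n)) (i : Fin n) (hi : i ∉ s) :
    ProbabilityTheory.IndepFun (fun E => ∑ k ∈ s, c k * E k j) (fun E => c i * E i j) P := by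
  have h1 := h.indep.precomp (g := fun i : Fin n => (i, j)) (fun a b hab => (Prod.mk.inj hab).1)
  have h2 := h1.comp (fun i x => c i * x) (fun i => measurable_const_mul (c i))
  have h3 := h2.indepFun_finsetSum_of_notMem
    (fun i => (measurable_const_mul (c i)).comp (by fun_prop)) hi
  convert h3 using 1
  · ext E
    simp
  · rfl

lemma indepFun_partial_sum_contrast (h : IsBernsteinNoise p n P L) (c : Fin n → ℝ)
    {f : Fin p → ℝ → ℝ} (hf : ∀ j, Measurable (f j))
    (s : Finset (Fin p)) (j : Fin p) (hj : j ∉ s) :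
    ProbabilityTheory.IndepFun (fun E => ∑ k ∈ s, f k (contrast c k E))
      (fun E => f j (contrast c j E)) P := by
  have hdisj : Disjoint ((Finset.univ : Finset (Fin n)) ×ˢ s)
      ((Finset.univ : Finset (Fin n)) ×ˢ ({j} : Finset (Fin p))) := by
    rw [Finset.disjoint_left]
    rintro ⟨a, b⟩ h1 h2
    simp only [Finset.mem_product, Finset.mem_univ, true_and, Finset.mem_singleton] at h1 h2
    exact hj (h2 ▸ h1)
  have hI := h.indep.indepFun_finset _ _ hdisj (fun a => by fun_prop)
  let φ : (((Finset.univ : Finset (Fin n)) ×ˢ s : Finset (Fin n × Fin p)) → ℝ) → ℝ := fun x =>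
    ∑ k ∈ s.attach, f k (∑ i, c i * x ⟨(i, k.1), by simp⟩)
  let ψ : (((Finset.univ : Finset (Fin n)) ×ˢ ({j} : Finset (Fin p)) :
      Finset (Fin n × Fin p)) → ℝ) → ℝ := fun x => f j (∑ i, c i * x ⟨(i, j), by simp⟩)
  have hφ : Measurable φ := Finset.measurable_fun_sum _ fun k _ =>
    (hf k).comp (Finset.measurable_fun_sum _ fun i _ => (measurable_pi_apply _).const_mul _)
  have hψ : Measurable ψ := (hf j).comp
    (Finset.measurable_fun_sum _ fun i _ => (measurable_pi_apply _).const_mul _)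
  have := hI.comp hφ hψ
  convert this using 1
  · ext E
    simp only [φ, Function.comp]
    exact (Finset.sum_attach s fun k => f k (∑ i, c i * E i k)).symm
  · rfl

lemma hasAllMoments_contrast (h : IsBernsteinNoise p n P L) (c : Fin n → ℝ) (j : Fin p) :
    HasAllMoments P (contrast c j) := by
  have := h.isProb
  exact HasAllMoments.sum (fun i => (h.moments i j).const_mul (c i)) Finset.univ

lemma integral_contrast (h : IsBernsteinNoise p n P L) (c : Fin n → ℝ) (j : Fin p) :
    ∫ E, contrast c j E ∂P = 0 := by
  unfold contrast
  rw [integral_finsetSum _ fun i _ => (h.moments i j).integrable.const_mul _]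
  simp [integral_const_mul, h.mean]

lemma integral_contrast_sq (h : IsBernsteinNoise p n P L) {c : Fin n → ℝ}
    (hc : ∑ i, c i ^ 2 = 1) (j : Fin p) : ∫ E, contrast c j E ^ 2 ∂P = 1 := by
  have := h.isProb
  have h1 := integral_sq_sum_eq (μ := P) (X := fun i E => c i * E i j)
    (fun i => (h.moments i j).const_mul (c i)) (h.indepFun_partial_sum c j)
    (fun i => by rw [integral_const_mul, h.mean, mul_zero]) Finset.univ
  simp only [mul_pow, integral_const_mul, h.var, mul_one, hc] at h1
  exact h1

/-- Sub-Gaussian growth of the moments of a normalised contrast, up to order `N`. -/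
lemma abs_integral_contrast_pow_le (h : IsBernsteinNoise p n P L) {c : Fin n → ℝ}
    (hc : ∑ i, c i ^ 2 = 1) {b : ℝ} (hb : ∀ i, |c i| ≤ b) (hb0 : 0 ≤ b) {N : ℕ} {l : ℝ}
    (hl : 0 < l) (hlb : l * (b * L N) ≤ 1 / 2) (j : Fin p) {m : ℕ} (hm : m ≤ N) :
    |∫ E, contrast c j E ^ m ∂P| ≤ m.factorial * (l ^ m)⁻¹ * Real.exp (2 * l ^ 2) := by
  have := h.isProb
  have hL := h.scale_nonneg N
  have h1 := abs_moment_sum_le (μ := P) (X := fun i E => c i * E i j)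
    (fun i => (h.moments i j).const_mul (c i)) (h.indepFun_partial_sum c j)
    (fun i => by rw [integral_const_mul, h.mean, mul_zero]) (N := N) (v := fun i => c i ^ 2)
    (H := b * L N) (l := l) (fun i => sq_nonneg _) (by positivity) hl hlb ?_ Finset.univ m hm
  · simpa only [hc, mul_one, contrast] using h1
  · intro i k hk hkN
    simp only [mul_pow, integral_const_mul, abs_mul, abs_pow]
    have h2 : |∫ E, E i j ^ k ∂P| ≤ k.factorial * L N ^ (k - 2) := by
      refine (abs_integral_le_integral_abs).trans ?_
      simp only [abs_pow]
      exact h.bernstein i j k N hk hkN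
    have h3 : |c i| ^ k ≤ c i ^ 2 * b ^ (k - 2) := by
      calc |c i| ^ k = |c i| ^ 2 * |c i| ^ (k - 2) := by rw [← pow_add]; congr 1; omega
        _ = c i ^ 2 * |c i| ^ (k - 2) := by rw [sq_abs]
        _ ≤ _ := by gcongr; exact hb i
    calc |c i| ^ k * |∫ E, E i j ^ k ∂P|
        ≤ (c i ^ 2 * b ^ (k - 2)) * (k.factorial * L N ^ (k - 2)) := by gcongr
      _ = _ := by ring

lemma integral_contrast_pow_two_mul_le (h : IsBernsteinNoise p n P L) {c : Fin n → ℝ}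
    (hc : ∑ i, c i ^ 2 = 1) {b : ℝ} (hb : ∀ i, |c i| ≤ b) (hb0 : 0 ≤ b) {q : ℕ} {B : ℝ}
    (hB : 1 ≤ B) (hqB : 4 * q * (b * L (2 * q)) ^ 2 ≤ B) (j : Fin p) {m : ℕ} (hm1 : 1 ≤ m)
    (hm : m ≤ q) :
    ∫ E, contrast c j E ^ (2 * m) ∂P ≤ m.factorial * (2 * B * Real.exp 2) ^ m := by
  have hL := h.scale_nonneg (2 * q)
  have hm0 : (0 : ℝ) < m := by exact_mod_cast hm1
  have hmq : (m : ℝ) ≤ q := by exact_mod_cast hm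
  have hsq : Real.sqrt (m / B) ^ 2 = m / B := Real.sq_sqrt (by positivity)
  have hlb : Real.sqrt (m / B) * (b * L (2 * q)) ≤ 1 / 2 := by
    refine abs_le_of_sq_le_sq' ?_ (by norm_num) |>.2
    rw [mul_pow, hsq, div_mul_eq_mul_div, div_le_iff₀ (by positivity)]
    have : (m : ℝ) * (b * L (2 * q)) ^ 2 ≤ q * (b * L (2 * q)) ^ 2 := by gcongr
    linarith
  have h1 := (le_abs_self _).trans (h.abs_integral_contrast_pow_le hc hb hb0
    (l := Real.sqrt (m / B)) (by positivity) hlb j (m := 2 * m) (by omega))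
  rw [pow_mul, hsq] at h1
  have hfac : ((2 * m).factorial : ℝ) ≤ (2 * m) ^ m * m.factorial := by
    exact_mod_cast Nat.factorial_two_mul_le m
  have hexp : Real.exp (2 * (m / B)) ≤ Real.exp 2 ^ m := by
    rw [← Real.exp_nat_mul]
    have := div_le_self hm0.le hB
    exact Real.exp_le_exp.2 (by linarith)
  calc _ ≤ _ := h1
    _ ≤ ((2 * m) ^ m * m.factorial) * ((m / B) ^ m)⁻¹ * Real.exp 2 ^ m := by gcongr
    _ = m.factorial * (((2 * m) * (m / B)⁻¹) * Real.exp 2) ^ m := by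
        rw [mul_pow _ (Real.exp 2), mul_pow (2 * (m : ℝ)) _⁻¹, inv_pow]; ring
    _ = _ := by
        congr 3
        field_simp

lemma abs_integral_contrast_sq_sub_one_pow_le (h : IsBernsteinNoise p n P L) {c : Fin n → ℝ}
    (hc : ∑ i, c i ^ 2 = 1) {b : ℝ} (hb : ∀ i, |c i| ≤ b) (hb0 : 0 ≤ b) {q : ℕ} {B : ℝ}
    (hB : 1 ≤ B) (hqB : 4 * q * (b * L (2 * q)) ^ 2 ≤ B) (j : Fin p) {m : ℕ} (hm1 : 1 ≤ m)
    (hm : m ≤ q) :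
    |∫ E, (contrast c j E ^ 2 - 1) ^ m ∂P| ≤ m.factorial * (4 * B * Real.exp 2) ^ m := by
  have := h.isProb
  have hY := h.hasAllMoments_contrast c j
  have hpt : ∀ E : Fin n → Fin p → ℝ,
      |(contrast c j E ^ 2 - 1) ^ m| ≤ contrast c j E ^ (2 * m) + 1 := by
    intro E
    rw [abs_pow, pow_mul]
    have hy : 0 ≤ contrast c j E ^ 2 := sq_nonneg _
    have h1 : |contrast c j E ^ 2 - 1| ≤ max (contrast c j E ^ 2) 1 := by
      rw [abs_le]
      constructor <;> linarith [le_max_left (contrast c j E ^ 2) 1,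
        le_max_right (contrast c j E ^ 2) 1]
    refine (pow_le_pow_left₀ (abs_nonneg _) h1 m).trans ?_
    rcases max_cases (contrast c j E ^ 2) 1 with hx | hx <;> rw [hx.1]
    · linarith
    · rw [one_pow]
      linarith [pow_nonneg hy m]
  have hintegral := (hY.integrable_pow (2 * m)).add (integrable_const (1 : ℝ))
  have hbd := h.integral_contrast_pow_two_mul_le hc hb hb0 hB hqB j hm1 hm
  have hf1 : (1 : ℝ) ≤ m.factorial := by exact_mod_cast Nat.factorial_pos m
  have hz : 1 ≤ 2 * B * Real.exp 2 := by nlinarith [Real.add_one_le_exp (2 : ℝ)]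
  have hzm : 1 ≤ (2 * B * Real.exp 2) ^ m := one_le_pow₀ hz
  have h2m : (2 : ℝ) ≤ 2 ^ m := by
    simpa using pow_le_pow_right₀ (by norm_num : (1 : ℝ) ≤ 2) hm1
  calc |∫ E, (contrast c j E ^ 2 - 1) ^ m ∂P|
      ≤ ∫ E, |(contrast c j E ^ 2 - 1) ^ m| ∂P := abs_integral_le_integral_abs
    _ ≤ ∫ E, (contrast c j E ^ (2 * m) + 1) ∂P :=
        integral_mono_of_nonneg (Filter.Eventually.of_forall fun E => abs_nonneg _) hintegral
          (Filter.Eventually.of_forall hpt)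
    _ = ∫ E, contrast c j E ^ (2 * m) ∂P + 1 := by
        rw [integral_add (hY.integrable_pow (2 * m)) (integrable_const _)]
        simp
    _ ≤ m.factorial * (2 * B * Real.exp 2) ^ m + m.factorial * (2 * B * Real.exp 2) ^ m := by
        gcongr
        exact one_le_mul_of_one_le_of_one_le hf1 hzm
    _ = 2 * (m.factorial * (2 * B * Real.exp 2) ^ m) := by ring
    _ ≤ 2 ^ m * (m.factorial * (2 * B * Real.exp 2) ^ m) := by gcongr
    _ = m.factorial * (2 * (2 * B * Real.exp 2)) ^ m := by rw [mul_pow 2]; ring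
    _ = _ := by ring

lemma hasAllMoments_contrast_sq_sub_one (h : IsBernsteinNoise p n P L) (c : Fin n → ℝ)
    (j : Fin p) : HasAllMoments P (fun E => contrast c j E ^ 2 - 1) := by
  have := h.isProb
  simpa only [sub_eq_add_neg] using (h.hasAllMoments_contrast c j).sq.add (.const (-1))

/-- Bernstein-type bound for the moments of the centred quadratic statistic. -/
lemma abs_integral_quadratic_pow_le (h : IsBernsteinNoise p n P L) {c : Fin n → ℝ}
    (hc : ∑ i, c i ^ 2 = 1) {b : ℝ} (hb : ∀ i, |c i| ≤ b) (hb0 : 0 ≤ b) {q : ℕ} {B : ℝ}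
    (hB : 1 ≤ B) (hqB : 4 * q * (b * L (2 * q)) ^ 2 ≤ B) {l : ℝ} (hl : 0 < l)
    (hlH : l * (4 * B * Real.exp 2) ≤ 1 / 2) {m : ℕ} (hm : m ≤ q) :
    |∫ E, (∑ j, (contrast c j E ^ 2 - 1)) ^ m ∂P| ≤
      m.factorial * (l ^ m)⁻¹ * Real.exp (2 * l ^ 2 * (p * (4 * B * Real.exp 2) ^ 2)) := by
  have := h.isProb
  have h1 := abs_moment_sum_le (μ := P) (X := fun j E => contrast c j E ^ 2 - 1)
    (h.hasAllMoments_contrast_sq_sub_one c)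
    (h.indepFun_partial_sum_contrast c (f := fun _ x => x ^ 2 - 1) (fun _ => by fun_prop))
    (fun j => ?_) (N := q) (v := fun _ => (4 * B * Real.exp 2) ^ 2)
    (H := 4 * B * Real.exp 2) (l := l) (fun i => sq_nonneg _) (by positivity) hl hlH ?_
    Finset.univ m hm
  · simpa using h1
  · rw [integral_sub ((h.hasAllMoments_contrast c j).integrable_pow 2) (integrable_const _),
      h.integral_contrast_sq hc]
    simp
  · intro j k hk hkq
    refine (h.abs_integral_contrast_sq_sub_one_pow_le hc hb hb0 hB hqB j
      (by omega) hkq).trans_eq ?_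
    rw [mul_assoc (k.factorial : ℝ), ← pow_add, Nat.add_sub_cancel' hk]

lemma integral_linear_sq (h : IsBernsteinNoise p n P L) {c : Fin n → ℝ}
    (hc : ∑ i, c i ^ 2 = 1) (δ : Fin p → ℝ) :
    ∫ E, (∑ j, δ j * contrast c j E) ^ 2 ∂P = ∑ j, δ j ^ 2 := by
  have := h.isProb
  have h1 := integral_sq_sum_eq (μ := P) (X := fun j E => δ j * contrast c j E)
    (fun j => (h.hasAllMoments_contrast c j).const_mul (δ j))
    (h.indepFun_partial_sum_contrast c (f := fun j x => δ j * x) (fun _ => by fun_prop))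
    (fun j => by rw [integral_const_mul, h.integral_contrast, mul_zero]) Finset.univ
  simp only [mul_pow, integral_const_mul, h.integral_contrast_sq hc, mul_one] at h1
  exact h1

end IsBernsteinNoise

/-- Moments of the quadratic statistic relative to the detection threshold. -/
lemma IsBernsteinNoise.integral_quadratic_div_pow_le {p n : ℕ}
    {P : Measure (Fin n → Fin p → ℝ)} {L : ℕ → ℝ} (h : IsBernsteinNoise p n P L)
    (hp : 0 < p) {c : Fin n → ℝ} (hc : ∑ i, c i ^ 2 = 1) {b : ℝ} (hb : ∀ i, |c i| ≤ b)
    (hb0 : 0 ≤ b) {q : ℕ} (hq : 1 ≤ q) {B : ℝ} (hB : 1 ≤ B)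
    (hqB : 4 * q * (b * L (2 * q)) ^ 2 ≤ B) {x a D : ℝ} (hx : 0 < x) (ha : 1 ≤ a)
    (hqx : q ≤ a * x) (hD : 0 < D) :
    ∫ E, ((∑ j, (contrast c j E ^ 2 - 1)) /
      (2 * (4 * B * Real.exp 2) * a * Real.exp 2 * D * (Real.sqrt (p * x) + x))) ^ q ∂P ≤
      (D⁻¹) ^ q := by
  set H : ℝ := 4 * B * Real.exp 2 with hH
  set r : ℝ := 2 * H * a * Real.exp 2 * D * (Real.sqrt (p * x) + x) with hr
  have hH0 : 0 < H := by positivity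
  have hp0 : (0 : ℝ) < p := by exact_mod_cast hp
  have hq0 : (0 : ℝ) < q := by exact_mod_cast hq
  have ha0 : 0 < a := by linarith
  have hr0 : 0 < r := by positivity
  set l : ℝ := min (1 / (2 * H)) (Real.sqrt (q / p) / H) with hl
  have hl0 : 0 < l := lt_min (by positivity) (by positivity)
  have hlH : l * H ≤ 1 / 2 := by
    calc l * H ≤ 1 / (2 * H) * H := by gcongr; exact min_le_left _ _
      _ = 1 / 2 := by field_simp
  have hlp : l ^ 2 * ((p : ℝ) * H ^ 2) ≤ (q : ℝ) := by
    calc l ^ 2 * ((p : ℝ) * H ^ 2)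
        ≤ (Real.sqrt ((q : ℝ) / p) / H) ^ 2 * ((p : ℝ) * H ^ 2) := by
          gcongr; exact min_le_right _ _
      _ = (q : ℝ) := by
          rw [div_pow, Real.sq_sqrt (by positivity)]; field_simp
  have hlr : q * Real.exp 2 * D ≤ l * r := by
    rcases min_choice (1 / (2 * H)) (Real.sqrt (q / p) / H) with hmin | hmin
    · rw [hl, hmin]
      calc q * Real.exp 2 * D ≤ a * x * Real.exp 2 * D := by gcongr
        _ = 1 / (2 * H) * (2 * H * a * Real.exp 2 * D * (0 + x)) := by field_simp; ring
        _ ≤ _ := by rw [hr]; gcongr; positivity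
    · rw [hl, hmin]
      have h1 : q / a ≤ Real.sqrt (q / p) * Real.sqrt (p * x) := by
        rw [← Real.sqrt_mul (by positivity)]
        apply Real.le_sqrt_of_sq_le
        have : (q : ℝ) / p * (p * x) = q * x := by field_simp
        rw [this, div_pow, div_le_iff₀ (by positivity)]
        have h2 : a * x ≤ a ^ 2 * x := by
          have : a ≤ a ^ 2 := by nlinarith
          gcongr
        calc (q : ℝ) ^ 2 = q * q := by ring
          _ ≤ q * (a ^ 2 * x) := by gcongr; linarith
          _ = _ := by ring
      calc q * Real.exp 2 * D = (q / a) * (a * Real.exp 2 * D) := by field_simp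
        _ ≤ (Real.sqrt (q / p) * Real.sqrt (p * x)) * (a * Real.exp 2 * D) := by gcongr
        _ ≤ 2 * ((Real.sqrt (q / p) * Real.sqrt (p * x)) * (a * Real.exp 2 * D)) := by
            have : 0 ≤ (Real.sqrt (q / p) * Real.sqrt (p * x)) * (a * Real.exp 2 * D) := by
              positivity
            linarith
        _ = Real.sqrt (q / p) / H *
            (2 * H * a * Real.exp 2 * D * (Real.sqrt (p * x) + 0)) := by
            field_simp; ring
        _ ≤ _ := by rw [hr]; gcongr
  have hmom := (le_abs_self _).trans
    (h.abs_integral_quadratic_pow_le hc hb hb0 hB hqB hl0 hlH le_rfl)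
  simp_rw [div_pow]
  rw [integral_div, div_le_iff₀ (by positivity)]
  have hfac : (q.factorial : ℝ) ≤ (q : ℝ) ^ q := by exact_mod_cast Nat.factorial_le_pow q
  have hexp : Real.exp (2 * l ^ 2 * (p * H ^ 2)) ≤ Real.exp 2 ^ q := by
    rw [← Real.exp_nat_mul]
    exact Real.exp_le_exp.2 (by linarith)
  calc _ ≤ _ := hmom
    _ ≤ (q : ℝ) ^ q * (l ^ q)⁻¹ * Real.exp 2 ^ q := by gcongr
    _ = (q * Real.exp 2 * D) ^ q * (l ^ q)⁻¹ * (D⁻¹) ^ q := by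
        rw [mul_pow, mul_pow, inv_pow]
        field_simp
    _ ≤ (l * r) ^ q * (l ^ q)⁻¹ * (D⁻¹) ^ q := by gcongr
    _ = (D⁻¹) ^ q * r ^ q := by rw [mul_pow]; field_simp

/-- The variance of the quadratic statistic is of order `p`. -/
lemma IsBernsteinNoise.integral_quadratic_sq_le {p n : ℕ}
    {P : Measure (Fin n → Fin p → ℝ)} {L : ℕ → ℝ} (h : IsBernsteinNoise p n P L)
    (hp : 0 < p) {c : Fin n → ℝ} (hc : ∑ i, c i ^ 2 = 1) {b : ℝ} (hb : ∀ i, |c i| ≤ b)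
    (hb0 : 0 ≤ b) {q : ℕ} (hq : 2 ≤ q) {B : ℝ} (hB : 1 ≤ B)
    (hqB : 4 * q * (b * L (2 * q)) ^ 2 ≤ B) :
    ∫ E, (∑ j, (contrast c j E ^ 2 - 1)) ^ 2 ∂P ≤ 24 * (4 * B * Real.exp 2) ^ 2 * p := by
  set H : ℝ := 4 * B * Real.exp 2 with hH
  have hH0 : 0 < H := by positivity
  have hp0 : (0 : ℝ) < p := by exact_mod_cast hp
  have hsp : 1 ≤ Real.sqrt p := by
    rw [Real.one_le_sqrt]; exact_mod_cast hp
  have hs2 : Real.sqrt p ^ 2 = p := Real.sq_sqrt hp0.le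
  have hmom := (le_abs_self _).trans
    (h.abs_integral_quadratic_pow_le hc hb hb0 hB hqB (l := 1 / (2 * H * Real.sqrt p))
      (by positivity) (by
        rw [← hH, div_mul_eq_mul_div, div_le_div_iff₀ (by positivity) (by norm_num)]
        nlinarith) hq)
  rw [← hH] at hmom
  refine hmom.trans ?_
  have h1 : 2 * (1 / (2 * H * Real.sqrt p)) ^ 2 * (p * H ^ 2) = 1 / 2 := by
    rw [div_pow, mul_pow, mul_pow, hs2]; field_simp
  have h2 : ((1 / (2 * H * Real.sqrt p)) ^ 2)⁻¹ = 4 * H ^ 2 * p := by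
    rw [div_pow, mul_pow, mul_pow, hs2, one_pow, one_div, inv_inv]; ring
  rw [h1, h2]
  have h3 : Real.exp (1 / 2) ≤ 3 :=
    (Real.exp_le_exp.2 (by norm_num : (1 / 2 : ℝ) ≤ 1)).trans Real.exp_one_lt_three.le
  have h4 : (Nat.factorial 2 : ℝ) = 2 := by norm_num
  rw [h4]
  calc 2 * (4 * H ^ 2 * p) * Real.exp (1 / 2) ≤ 2 * (4 * H ^ 2 * p) * 3 := by gcongr
    _ = _ := by ring

/-- The coefficients of the CUSUM statistic at scale `t`. -/
noncomputable def cusumCoef (n t : ℕ) (i : ℕ) : ℝ :=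
  ((if i < t then 1 else 0) - (if n - 1 - i < t then 1 else 0)) / Real.sqrt (2 * t)

lemma sum_range_ite_lt {n t : ℕ} (ht : t ≤ n) (g : ℕ → ℝ) :
    ∑ i ∈ Finset.range n, (if i < t then g i else 0) = ∑ i ∈ Finset.range t, g i := by
  rw [← Finset.sum_filter]
  congr 1
  ext i
  simp only [Finset.mem_filter, Finset.mem_range]
  omega

lemma sum_range_ite_reflect_lt {n t : ℕ} (ht : t ≤ n) (g : ℕ → ℝ) :
    ∑ i ∈ Finset.range n, (if n - 1 - i < t then g i else 0) =
      ∑ i ∈ Finset.range t, g (n - 1 - i) := by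
  rw [← sum_range_ite_lt ht, ← Finset.sum_range_reflect]
  refine Finset.sum_congr rfl fun i hi => ?_
  have hi' := Finset.mem_range.1 hi
  rw [show n - 1 - (n - 1 - i) = i by omega]

lemma Yt_eq_contrast {p n t : ℕ} (ht : t ≤ n) (X : Fin n → Fin p → ℝ) (j : Fin p) :
    Yt p n X t j = contrast (fun i : Fin n => cusumCoef n t i) j X := by
  have h1 : contrast (fun i : Fin n => cusumCoef n t i) j X =
      ∑ i ∈ Finset.range n, cusumCoef n t i * col p n X i j := by
    rw [← Fin.sum_univ_eq_sum_range (fun i => cusumCoef n t i * col p n X i j)]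
    simp [contrast, col]
  rw [h1, Yt, Finset.sum_sub_distrib, ← sum_range_ite_lt ht,
    ← sum_range_ite_reflect_lt ht fun i => col p n X i j, ← Finset.sum_sub_distrib,
    Finset.sum_div]
  refine Finset.sum_congr rfl fun i _ => ?_
  unfold cusumCoef
  split_ifs <;> ring

lemma abs_cusumCoef_le (n t i : ℕ) : |cusumCoef n t i| ≤ 1 / Real.sqrt (2 * t) := by
  rw [cusumCoef, abs_div, abs_of_nonneg (Real.sqrt_nonneg _)]
  gcongr
  split_ifs <;> norm_num

lemma sum_cusumCoef_sq {n t : ℕ} (ht : 1 ≤ t) (htn : 2 * t ≤ n) :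
    ∑ i : Fin n, cusumCoef n t i ^ 2 = 1 := by
  have ht0 : (0 : ℝ) < t := by exact_mod_cast ht
  rw [Fin.sum_univ_eq_sum_range (fun i => cusumCoef n t i ^ 2)]
  have h1 : ∀ i ∈ Finset.range n, cusumCoef n t i ^ 2 =
      ((if i < t then 1 else 0) + (if n - 1 - i < t then 1 else 0)) / (2 * t) := by
    intro i hi
    have hi' := Finset.mem_range.1 hi
    rw [cusumCoef, div_pow, Real.sq_sqrt (by positivity)]
    congr 1
    split_ifs <;> first | omega | norm_num
  rw [Finset.sum_congr rfl h1, ← Finset.sum_div, Finset.sum_add_distrib,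
    sum_range_ite_lt (by omega), sum_range_ite_reflect_lt (by omega)]
  simp only [Finset.sum_const, Finset.card_range, nsmul_eq_mul, mul_one]
  field_simp
  norm_num

lemma contrast_add {p n : ℕ} (c : Fin n → ℝ) (j : Fin p) (θ E : Fin n → Fin p → ℝ) :
    contrast c j (θ + E) = contrast c j θ + contrast c j E := by
  simp [contrast, mul_add, Finset.sum_add_distrib]

/-- The CUSUM contrast of a signal which is constant on the first and on the last `t` times. -/
lemma contrast_cusumCoef_of_const {p n t : ℕ} (htn : t ≤ n) {θ : Fin n → Fin p → ℝ}
    {μ₁ μ₂ : Fin p → ℝ} (h1 : ∀ i : Fin n, (i : ℕ) < t → θ i = μ₁)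
    (h2 : ∀ i : Fin n, n - t ≤ (i : ℕ) → θ i = μ₂) (j : Fin p) :
    contrast (fun i : Fin n => cusumCoef n t i) j θ =
      t * (μ₁ j - μ₂ j) / Real.sqrt (2 * t) := by
  rw [← Yt_eq_contrast htn, Yt]
  congr 1
  rw [Finset.sum_congr rfl (g := fun _ => μ₁ j - μ₂ j)]
  · simp [mul_sub]
  · intro i hi
    have hi' := Finset.mem_range.1 hi
    have ha : i < n := by omega
    have hb : n - 1 - i < n := by omega
    simp only [col, ha, hb, dif_pos]
    rw [h1 ⟨i, ha⟩ hi', h2 ⟨n - 1 - i, hb⟩ (by simp; omega)]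

lemma mem_Tgrid {n t : ℕ} (hn : 2 ≤ n) :
    t ∈ Tgrid n ↔ ∃ k, k ≤ Nat.log 2 (n / 2) ∧ 2 ^ k = t ∧ 2 * 2 ^ k ≤ n := by
  simp only [Tgrid, Finset.mem_image, Finset.mem_range]
  constructor
  · rintro ⟨k, hk, rfl⟩
    have := Nat.pow_le_of_le_log (b := 2) (x := k) (y := n / 2) (by omega) (by omega)
    exact ⟨k, by omega, rfl, by omega⟩
  · rintro ⟨k, hk, rfl, _⟩
    exact ⟨k, by omega, rfl⟩

lemma one_le_LL {n : ℕ} (hn : 2 ≤ n) : 1 ≤ LL n := by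
  have hn' : (2 : ℝ) ≤ n := by exact_mod_cast hn
  have h16 : Real.exp 1 ≤ Real.log (8 * n) := by
    have h1 : Real.log ((2 : ℝ) ^ 4) ≤ Real.log (8 * n) :=
      Real.log_le_log (by norm_num) (by linarith)
    rw [Real.log_pow] at h1
    push_cast at h1
    linarith [Real.log_two_gt_d9, Real.exp_one_lt_d9]
  rw [LL, Real.le_log_iff_exp_le ((Real.exp_pos 1).trans_le h16)]
  exact h16

/-- The order of the moment used to control the statistic at scale `2 ^ k`. -/
def momentOrder (k : ℕ) : ℕ := 2 * (Nat.log 2 (k + 1) + 1)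

lemma momentOrder_le_LL {n k : ℕ} (hn : 2 ≤ n) (hk : 2 * 2 ^ k ≤ n) :
    (momentOrder k : ℝ) ≤ 8 * LL n := by
  have hLL := one_le_LL hn
  have hn' : (2 : ℝ) ≤ n := by exact_mod_cast hn
  have hl2 := Real.log_two_gt_d9
  have h1 : ((k : ℝ) + 1) * Real.log 2 ≤ Real.log n := by
    have : ((2 : ℝ) ^ (k + 1)) ≤ n := by
      rw [pow_succ, mul_comm]; exact_mod_cast hk
    have := Real.log_le_log (by positivity) this
    rwa [Real.log_pow, Nat.cast_succ] at this
  have h2 : Real.log n ≤ Real.log (8 * n) := Real.log_le_log (by linarith) (by linarith)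
  have h3 : (k : ℝ) + 1 ≤ 2 * Real.log (8 * n) := by
    have : (0 : ℝ) ≤ k := by positivity
    nlinarith
  have hpos : 0 < Real.log (8 * n) := Real.log_pos (by linarith)
  have h4 : Real.log (k + 1) ≤ Real.log 2 + LL n := by
    rw [LL, ← Real.log_mul (by norm_num) hpos.ne']
    exact Real.log_le_log (by positivity) h3
  have h5 : (Nat.log 2 (k + 1) : ℝ) * Real.log 2 ≤ Real.log (k + 1) := by
    have : ((2 : ℝ) ^ (Nat.log 2 (k + 1))) ≤ (k : ℝ) + 1 := by
      exact_mod_cast Nat.pow_log_le_self 2 (by omega : k + 1 ≠ 0)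
    have := Real.log_le_log (by positivity) this
    rwa [Real.log_pow] at this
  have h6 : (Nat.log 2 (k + 1) : ℝ) ≤ 1 + 2 * LL n := by
    have : (0 : ℝ) ≤ (Nat.log 2 (k + 1) : ℝ) := by positivity
    nlinarith
  unfold momentOrder
  push_cast
  linarith

lemma sum_inv_pow_momentOrder_le {M : ℝ} (hM : 1 ≤ M) (m : ℕ) :
    ∑ k ∈ Finset.range m, ((4 * M)⁻¹) ^ momentOrder k ≤ 2 / M := by
  have hM0 : 0 < M := by linarith
  have hterm : ∀ k : ℕ, ((4 * M)⁻¹) ^ momentOrder k ≤ 1 / M * (1 / ((k : ℝ) + 1) ^ 2) := by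
    intro k
    set a := Nat.log 2 (k + 1)
    have hk : (k : ℝ) + 1 ≤ 2 ^ (a + 1) := by
      exact_mod_cast (Nat.lt_pow_succ_log_self (by norm_num : 1 < 2) (k + 1)).le
    have h1 : M * ((k : ℝ) + 1) ^ 2 ≤ (4 * M) ^ momentOrder k := by
      have hM2 : M ≤ M ^ momentOrder k := le_self_pow₀ hM (by unfold momentOrder; omega)
      calc M * ((k : ℝ) + 1) ^ 2 ≤ M ^ momentOrder k * (2 ^ (a + 1)) ^ 2 := by gcongr
        _ = M ^ momentOrder k * 2 ^ momentOrder k := by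
            rw [← pow_mul, mul_comm (a + 1)]; rfl
        _ ≤ M ^ momentOrder k * 4 ^ momentOrder k := by gcongr; norm_num
        _ = _ := by rw [mul_pow]; ring
    rw [inv_pow, ← one_div, one_div_mul_one_div]
    gcongr
  have hsum : ∀ m : ℕ, ∑ k ∈ Finset.range m, 1 / ((k : ℝ) + 1) ^ 2 ≤ 2 - 2 / ((m : ℝ) + 1) := by
    intro m
    induction m with
    | zero => simp
    | succ m ih =>
      rw [Finset.sum_range_succ]
      have : 1 / ((m : ℝ) + 1) ^ 2 ≤ 2 / ((m : ℝ) + 1) - 2 / ((m : ℝ) + 1 + 1) := by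
        rw [div_sub_div _ _ (by positivity) (by positivity),
          div_le_div_iff₀ (by positivity) (by positivity)]
        have : (0 : ℝ) ≤ m := by positivity
        nlinarith [mul_nonneg this this, mul_nonneg this (mul_nonneg this this)]
      push_cast
      linarith
  calc _ ≤ ∑ k ∈ Finset.range m, 1 / M * (1 / ((k : ℝ) + 1) ^ 2) :=
        Finset.sum_le_sum fun k _ => hterm k
    _ = 1 / M * ∑ k ∈ Finset.range m, 1 / ((k : ℝ) + 1) ^ 2 := by rw [Finset.mul_sum]
    _ ≤ 1 / M * 2 := by
        gcongr
        have h1 := hsum m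
        have : (0 : ℝ) ≤ 2 / ((m : ℝ) + 1) := by positivity
        linarith
    _ = 2 / M := by ring

/-- The sub-Weibull scale at the moment order used for `2 ^ k` grows slower than `2 ^ k`. -/
lemma exists_momentOrder_scale_bound (K : ℝ) (d : ℕ) :
    ∃ B : ℝ, 1 ≤ B ∧ ∀ k : ℕ, 4 * (momentOrder k : ℝ) *
      (1 / Real.sqrt (2 * (2 ^ k : ℕ)) * weibullScale K d (2 * momentOrder k)) ^ 2 ≤ B := by
  have hq : ∀ k : ℕ, momentOrder k ≤ 2 * (k + 1) := fun k => by
    have := Nat.log_lt_self 2 (by omega : k + 1 ≠ 0)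
    unfold momentOrder
    omega
  have htend := tendsto_pow_const_div_const_pow_of_one_lt (6 * d + 1) (by norm_num : (1 : ℝ) < 2)
  obtain ⟨M, hM⟩ := htend.bddAbove_range
  set Q : ℝ := 8 * (3 * max 1 K * ((d : ℝ) * 4) ^ d) ^ 6 with hQ
  have hQ0 : 0 ≤ Q := by positivity
  refine ⟨max 1 (Q * M), le_max_left _ _, fun k => le_trans ?_ (le_max_right _ _)⟩
  have hk : (momentOrder k : ℝ) ≤ 2 * ((k : ℝ) + 1) := by exact_mod_cast hq k
  have hk2 : ((2 * momentOrder k : ℕ) : ℝ) ≤ 4 * ((k : ℝ) + 1) := by push_cast; linarith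
  have h1 : (((k + 1 : ℕ) : ℝ)) ^ (6 * d + 1) / 2 ^ (k + 1) ≤ M := hM ⟨k + 1, rfl⟩
  have hs : Real.sqrt (2 * (2 ^ k : ℕ)) ^ 2 = 2 ^ (k + 1) := by
    rw [Real.sq_sqrt (by positivity)]; push_cast; ring
  have hw : weibullScale K d (2 * momentOrder k) ^ 2 ≤
      ((3 * max 1 K * ((d : ℝ) * (4 * ((k : ℝ) + 1))) ^ d) ^ 3) ^ 2 := by
    unfold weibullScale
    gcongr
  rw [mul_pow, div_pow, hs, one_pow]
  calc 4 * (momentOrder k : ℝ) *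
        (1 / 2 ^ (k + 1) * weibullScale K d (2 * momentOrder k) ^ 2)
      ≤ 4 * (2 * ((k : ℝ) + 1)) * (1 / 2 ^ (k + 1) *
          ((3 * max 1 K * ((d : ℝ) * (4 * ((k : ℝ) + 1))) ^ d) ^ 3) ^ 2) :=
        mul_le_mul (by linarith) (mul_le_mul_of_nonneg_left hw (by positivity))
          (by positivity) (by positivity)
    _ = Q * ((((k + 1 : ℕ) : ℝ)) ^ (6 * d + 1) / 2 ^ (k + 1)) := by
        have h2 : ((k : ℝ) + 1) ^ (6 * d + 1) = (((k : ℝ) + 1) ^ d) ^ 6 * ((k : ℝ) + 1) := by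
          rw [pow_succ, mul_comm 6 d, pow_mul]
        rw [hQ]
        push_cast
        rw [← mul_assoc (d : ℝ) 4, mul_pow ((d : ℝ) * 4), h2]
        ring
    _ ≤ Q * M := by gcongr

lemma At_eq_sum_contrast {p n t : ℕ} (ht : t ≤ n) (X : Fin n → Fin p → ℝ) :
    At p n X t = ∑ j, (contrast (fun i : Fin n => cusumCoef n t i) j X ^ 2 - 1) := by
  simp only [At, Yt_eq_contrast ht]

/-- A signal in `ThetaAt` has a large CUSUM contrast at some scale of the dyadic grid. -/
lemma exists_scale_of_mem_ThetaAt {p n t0 s : ℕ} {ρ : ℝ} {θ : Fin n → Fin p → ℝ}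
    (h1 : 1 ≤ t0) (h2 : t0 ≤ n - 1) (hθ : θ ∈ ThetaAt p n t0 s ρ) :
    ∃ k, k ≤ Nat.log 2 (n / 2) ∧ 2 * 2 ^ k ≤ n ∧
      ρ ^ 2 / 4 ≤ ∑ j, contrast (fun i : Fin n => cusumCoef n (2 ^ k) i) j θ ^ 2 := by
  obtain ⟨μ₁, μ₂, hμ₁, hμ₂, -, hρ⟩ := hθ
  set m := min t0 (n - t0) with hm
  have hm0 : m ≠ 0 := by omega
  have hle : 2 ^ Nat.log 2 m ≤ m := Nat.pow_log_le_self 2 hm0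
  have hlt : m < 2 ^ (Nat.log 2 m + 1) := Nat.lt_pow_succ_log_self (by norm_num) m
  refine ⟨Nat.log 2 m, Nat.log_mono_right (by omega), by omega, ?_⟩
  set t := 2 ^ Nat.log 2 m with ht
  have ht0 : (0 : ℝ) < t := by rw [ht]; positivity
  have hn0 : (0 : ℝ) < n := by exact_mod_cast (by omega : 0 < n)
  have hm2 : (m : ℝ) ≤ 2 * t := by
    have : m ≤ 2 * t := by rw [pow_succ] at hlt; omega
    exact_mod_cast this
  have hfac : (t0 : ℝ) * ((n : ℝ) - t0) / n ≤ 2 * t := by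
    refine le_trans ?_ hm2
    rw [div_le_iff₀ hn0, ← Nat.cast_sub (by omega : t0 ≤ n)]
    have : t0 * (n - t0) ≤ m * n := by
      rcases le_total t0 (n - t0) with h | h
      · rw [hm, min_eq_left h]; exact Nat.mul_le_mul_left _ (by omega)
      · rw [hm, min_eq_right h, mul_comm]; exact Nat.mul_le_mul_left _ (by omega)
    exact_mod_cast this
  have hsq : ∑ j, contrast (fun i : Fin n => cusumCoef n t i) j θ ^ 2 =
      t / 2 * sqnorm p (fun j => μ₁ j - μ₂ j) := by
    rw [sqnorm, Finset.mul_sum]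
    refine Finset.sum_congr rfl fun j _ => ?_
    rw [contrast_cusumCoef_of_const (by omega) (fun i hi => hμ₁ i (by omega))
      (fun i hi => hμ₂ i (by omega)), div_pow, Real.sq_sqrt (by positivity)]
    field_simp
  have hsn : 0 ≤ sqnorm p (fun j => μ₁ j - μ₂ j) := Finset.sum_nonneg fun j _ => sq_nonneg _
  rw [hsq]
  have := hρ.trans (mul_le_mul_of_nonneg_right hfac hsn)
  linarith

lemma phiGdense_mem_Icc (p n : ℕ) (r : ℝ) (X : Fin n → Fin p → ℝ) :
    phiGdense p n r X ∈ Set.Icc (0 : ℝ) 1 := by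
  unfold phiGdense
  split_ifs <;> simp

namespace IsBernsteinNoise

variable {p n : ℕ} {P : Measure (Fin n → Fin p → ℝ)} {L : ℕ → ℝ}

lemma hasAllMoments_quadratic (h : IsBernsteinNoise p n P L) (c : Fin n → ℝ) :
    HasAllMoments P fun E => ∑ j, (contrast c j E ^ 2 - 1) := by
  have := h.isProb
  exact HasAllMoments.sum (fun j => h.hasAllMoments_contrast_sq_sub_one c j) Finset.univ

/-- Type I error of the dense test. -/
lemma integral_phiGdense_null_le (h : IsBernsteinNoise p n P L) (hp : 0 < p) (hn : 2 ≤ n)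
    {B : ℝ} (hB : 1 ≤ B)
    (hscale : ∀ k : ℕ, 4 * (momentOrder k : ℝ) *
      (1 / Real.sqrt (2 * (2 ^ k : ℕ)) * L (2 * momentOrder k)) ^ 2 ≤ B)
    {M : ℝ} (hM : 1 ≤ M) {θ : Fin n → Fin p → ℝ} (hθ : θ ∈ Theta0 p n) :
    ∫ E, phiGdense p n (2 * (4 * B * Real.exp 2) * 8 * Real.exp 2 * (4 * M) *
      (Real.sqrt (p * LL n) + LL n)) (θ + E) ∂P ≤ 2 / M := by
  have hLL := one_le_LL hn
  set r : ℝ := 2 * (4 * B * Real.exp 2) * 8 * Real.exp 2 * (4 * M) *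
      (Real.sqrt (p * LL n) + LL n) with hr
  have hr0 : 0 < r := by positivity
  obtain ⟨μ, hμ⟩ := hθ
  set A : ℕ → (Fin n → Fin p → ℝ) → ℝ := fun k E =>
    ∑ j, (contrast (fun i : Fin n => cusumCoef n (2 ^ k) i) j E ^ 2 - 1) with hA
  have hAt : ∀ k, 2 * 2 ^ k ≤ n → ∀ E, At p n (θ + E) (2 ^ k) = A k E := by
    intro k hk E
    rw [At_eq_sum_contrast (by omega)]
    refine Finset.sum_congr rfl fun j _ => ?_
    rw [contrast_add, contrast_cusumCoef_of_const (μ₁ := μ) (μ₂ := μ) (by omega)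
      (fun i _ => hμ i) (fun i _ => hμ i)]
    simp
  set s := Finset.range (Nat.log 2 (n / 2) + 1) with hs
  have hks : ∀ k ∈ s, 2 * 2 ^ k ≤ n := by
    intro k hk
    obtain ⟨k', _, hk', hkn⟩ := (mem_Tgrid hn).1 (Finset.mem_image_of_mem (fun k => 2 ^ k) hk)
    omega
  have hintegral : ∀ k, Integrable (fun E => (A k E / r) ^ momentOrder k) P := by
    intro k
    simp_rw [div_pow]
    exact ((h.hasAllMoments_quadratic _).integrable_pow _).div_const _
  have heven : ∀ k, Even (momentOrder k) := fun k => even_two_mul _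
  have hpt : ∀ E, phiGdense p n r (θ + E) ≤ ∑ k ∈ s, (A k E / r) ^ momentOrder k := by
    intro E
    have hnn : ∀ k ∈ s, 0 ≤ (A k E / r) ^ momentOrder k := fun k _ => (heven k).pow_nonneg _
    unfold phiGdense
    split_ifs with hex
    · obtain ⟨t, ht, hrt⟩ := hex
      obtain ⟨k, hk, rfl⟩ := Finset.mem_image.1 ht
      rw [hAt k (hks k hk)] at hrt
      refine le_trans ?_ (Finset.single_le_sum hnn hk)
      exact one_le_pow₀ ((one_le_div hr0).2 hrt.le)
    · exact Finset.sum_nonneg hnn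
  calc ∫ E, phiGdense p n r (θ + E) ∂P
      ≤ ∫ E, ∑ k ∈ s, (A k E / r) ^ momentOrder k ∂P :=
        integral_mono_of_nonneg (.of_forall fun E => (phiGdense_mem_Icc _ _ _ _).1)
          (integrable_finsetSum _ fun k _ => hintegral k) (.of_forall hpt)
    _ = ∑ k ∈ s, ∫ E, (A k E / r) ^ momentOrder k ∂P := integral_finsetSum _ fun k _ =>
        hintegral k
    _ ≤ ∑ k ∈ s, ((4 * M)⁻¹) ^ momentOrder k := by
        refine Finset.sum_le_sum fun k hk => ?_
        exact h.integral_quadratic_div_pow_le hp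
          (sum_cusumCoef_sq Nat.one_le_two_pow (hks k hk)) (fun i => abs_cusumCoef_le n (2 ^ k) i)
          (by positivity) (by unfold momentOrder; omega) hB (hscale k) (by linarith)
          (by norm_num) (momentOrder_le_LL hn (hks k hk)) (by positivity)
    _ ≤ 2 / M := sum_inv_pow_momentOrder_le hM _

/-- Type II error of the dense test at a scale where the signal is visible. -/
lemma integral_one_sub_phiGdense_le (h : IsBernsteinNoise p n P L) (hp : 0 < p)
    {k : ℕ} (hk : k ≤ Nat.log 2 (n / 2)) (hkn : 2 * 2 ^ k ≤ n) {B : ℝ} (hB : 1 ≤ B)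
    (hscale : 4 * (momentOrder k : ℝ) *
      (1 / Real.sqrt (2 * (2 ^ k : ℕ)) * L (2 * momentOrder k)) ^ 2 ≤ B)
    {θ : Fin n → Fin p → ℝ} {r D : ℝ} (hD : 0 < D) (hrD : 2 * r ≤ D)
    (hθ : D ≤ ∑ j, contrast (fun i : Fin n => cusumCoef n (2 ^ k) i) j θ ^ 2) :
    ∫ E, (1 - phiGdense p n r (θ + E)) ∂P ≤
      384 * (4 * B * Real.exp 2) ^ 2 * p / D ^ 2 + 64 / D := by
  have := h.isProb
  set c : Fin n → ℝ := fun i => cusumCoef n (2 ^ k) i with hc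
  set δ : Fin p → ℝ := fun j => contrast c j θ with hδ
  set S : ℝ := ∑ j, δ j ^ 2 with hS
  set A : (Fin n → Fin p → ℝ) → ℝ := fun E => ∑ j, (contrast c j E ^ 2 - 1) with hA
  set G : (Fin n → Fin p → ℝ) → ℝ := fun E => ∑ j, δ j * contrast c j E with hG
  have hS0 : 0 < S := hD.trans_le hθ
  have hc1 : ∑ i, c i ^ 2 = 1 := sum_cusumCoef_sq Nat.one_le_two_pow hkn
  have hAt : ∀ E, At p n (θ + E) (2 ^ k) = A E + 2 * G E + S := by
    intro E
    rw [At_eq_sum_contrast (by omega), hA, hG, hS]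
    simp only [Finset.mul_sum, ← Finset.sum_add_distrib]
    refine Finset.sum_congr rfl fun j _ => ?_
    rw [contrast_add]
    ring
  have hpt : ∀ E, 1 - phiGdense p n r (θ + E) ≤ 16 / S ^ 2 * A E ^ 2 + 64 / S ^ 2 * G E ^ 2 := by
    intro E
    unfold phiGdense
    split_ifs with hex
    · rw [sub_self]; positivity
    · push Not at hex
      have h1 := hex _ (Finset.mem_image_of_mem (fun k => 2 ^ k)
        (Finset.mem_range.2 (Nat.lt_succ_of_le hk)))
      simp only [hAt] at h1
      rw [div_mul_eq_mul_div, div_mul_eq_mul_div, ← add_div, le_div_iff₀ (by positivity)]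
      rcases le_or_gt (4 * A E) (-S) with h2 | h2
      · nlinarith [sq_nonneg (G E)]
      · have h3 : 8 * G E ≤ -S := by linarith
        nlinarith [sq_nonneg (A E)]
  have hAint : Integrable (fun E => A E ^ 2) P := (h.hasAllMoments_quadratic c).integrable_pow 2
  have hGint : Integrable (fun E => G E ^ 2) P :=
    (HasAllMoments.sum (fun j => (h.hasAllMoments_contrast c j).const_mul (δ j))
      Finset.univ).integrable_pow 2
  have hAle : ∫ E, A E ^ 2 ∂P ≤ 24 * (4 * B * Real.exp 2) ^ 2 * p :=
    h.integral_quadratic_sq_le hp hc1 (fun i => abs_cusumCoef_le n (2 ^ k) i) (by positivity)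
      (by unfold momentOrder; omega) hB hscale
  have hGeq : ∫ E, G E ^ 2 ∂P = S := h.integral_linear_sq hc1 δ
  calc ∫ E, (1 - phiGdense p n r (θ + E)) ∂P
      ≤ ∫ E, (16 / S ^ 2 * A E ^ 2 + 64 / S ^ 2 * G E ^ 2) ∂P :=
        integral_mono_of_nonneg
          (.of_forall fun E => sub_nonneg.2 (phiGdense_mem_Icc _ _ _ _).2)
          ((hAint.const_mul _).add (hGint.const_mul _)) (.of_forall hpt)
    _ = 16 / S ^ 2 * ∫ E, A E ^ 2 ∂P + 64 / S ^ 2 * S := by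
        rw [integral_add (hAint.const_mul _) (hGint.const_mul _), integral_const_mul,
          integral_const_mul, hGeq]
    _ ≤ 16 / S ^ 2 * (24 * (4 * B * Real.exp 2) ^ 2 * p) + 64 / S ^ 2 * S := by gcongr
    _ = 384 * (4 * B * Real.exp 2) ^ 2 * p / S ^ 2 + 64 / S := by field_simp; ring
    _ ≤ 384 * (4 * B * Real.exp 2) ^ 2 * p / D ^ 2 + 64 / D := by gcongr

end IsBernsteinNoise

/-- The signal strength constant makes the type II error bound at most `ε / 2`. -/
lemma type_two_error_budget {ε C : ℝ} (hε0 : 0 < ε) (hε1 : ε < 1) (hC : 0 < C) (H : ℝ)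
    {p y : ℝ} (hp : 1 ≤ p) (hy : Real.sqrt p ≤ y) :
    2 * (C * y) ≤ (8 * C + 40000 * (H ^ 2 + 1) / ε) * y / 4 ∧
      384 * H ^ 2 * p / ((8 * C + 40000 * (H ^ 2 + 1) / ε) * y / 4) ^ 2 +
        64 / ((8 * C + 40000 * (H ^ 2 + 1) / ε) * y / 4) ≤ ε / 2 := by
  have hp0 : 0 < p := by linarith
  have hsp : 1 ≤ Real.sqrt p := Real.one_le_sqrt.2 hp
  have hy0 : 0 < y := by linarith
  set Q : ℝ := 10000 * (H ^ 2 + 1) / ε with hQ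
  have hQ0 : 0 < Q := by positivity
  have hQε : Q * ε = 10000 * (H ^ 2 + 1) := by rw [hQ]; field_simp
  have hQ1 : 1 ≤ Q := by
    have : ε ≤ Q * ε := by rw [hQε]; nlinarith [sq_nonneg H]
    exact le_of_mul_le_mul_right (by linarith) hε0
  have hDeq : (8 * C + 40000 * (H ^ 2 + 1) / ε) * y / 4 = 2 * (C * y) + Q * y := by
    rw [hQ]; ring
  rw [hDeq]
  have hCy : 0 < C * y := by positivity
  have hQy : 0 < Q * y := by positivity
  set D : ℝ := 2 * (C * y) + Q * y with hD
  have hDQ : Q * Real.sqrt p ≤ D := by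
    have : Q * Real.sqrt p ≤ Q * y := by gcongr
    linarith
  have hD1 : Q ≤ D := le_trans (le_mul_of_one_le_right hQ0.le hsp) hDQ
  have hD0 : 0 < D := hQ0.trans_le hD1
  have hD2 : Q * p ≤ D ^ 2 := by
    calc Q * p ≤ Q ^ 2 * p := by gcongr; nlinarith
      _ = (Q * Real.sqrt p) ^ 2 := by rw [mul_pow, Real.sq_sqrt hp0.le]
      _ ≤ D ^ 2 := by gcongr
  have h1 : 384 * H ^ 2 * p / D ^ 2 ≤ ε / 4 := by
    rw [div_le_iff₀ (by positivity)]
    calc 384 * H ^ 2 * p ≤ Q * ε / 4 * p := by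
          rw [hQε]; gcongr; nlinarith [sq_nonneg H]
      _ = ε / 4 * (Q * p) := by ring
      _ ≤ ε / 4 * D ^ 2 := by gcongr
  have h2 : 64 / D ≤ ε / 4 := by
    rw [div_le_iff₀ hD0]
    calc (64 : ℝ) ≤ Q * ε / 4 := by rw [hQε]; nlinarith [sq_nonneg H]
      _ = ε / 4 * Q := by ring
      _ ≤ ε / 4 * D := by gcongr
  exact ⟨by linarith, by linarith⟩

/-- Theorem: dense testing under sub-Weibull noise.
For any `ε ∈ (0,1)` there are constants `C₁, C₂ > 0` depending only on `α, K, ε` such that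
the dense CUSUM test with threshold `r = C₁(√(p log log 8n) + log log 8n)` has worst-case
testing error at most `ε` whenever `ρ² ≥ C₂(√(p log log 8n) + log log 8n)`. -/
theorem statement_0 (α K ε : ℝ) (hα0 : 0 < α) (hα2 : α ≤ 2) (hK : 0 < K)
    (hε0 : 0 < ε) (hε1 : ε < 1) :
    ∃ C₁ C₂ : ℝ, 0 < C₁ ∧ 0 < C₂ ∧
      ∀ p n s : ℕ, 0 < p → 2 ≤ n → 1 ≤ s → s ≤ p → ∀ ρ : ℝ,
        C₂ * (Real.sqrt ((p : ℝ) * LL n) + LL n) ≤ ρ ^ 2 →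
        risk p n (Gclass p n α K) (Theta1 p n s ρ)
          (phiGdense p n (C₁ * (Real.sqrt ((p : ℝ) * LL n) + LL n))) ≤ ε := by
  obtain ⟨d, hd⟩ : ∃ d : ℕ, 1 ≤ α * d := by
    obtain ⟨d, hd⟩ := exists_nat_ge (1 / α)
    exact ⟨d, by rwa [div_le_iff₀' hα0] at hd⟩
  obtain ⟨B, hB, hscale⟩ := exists_momentOrder_scale_bound K d
  set H : ℝ := 4 * B * Real.exp 2 with hH
  have hH0 : 0 < H := by positivity
  set C₁ : ℝ := 2 * H * 8 * Real.exp 2 * (4 * (4 / ε)) with hC₁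
  have hC₁0 : 0 < C₁ := by positivity
  set C₂ : ℝ := 8 * C₁ + 40000 * (H ^ 2 + 1) / ε with hC₂
  refine ⟨C₁, C₂, hC₁0, by positivity, ?_⟩
  intro p n s hp hn _ _ ρ hρ
  have hp0 : (0 : ℝ) < p := by exact_mod_cast hp
  have hLL := one_le_LL hn
  have hnoise : ∀ P ∈ Gclass p n α K, IsBernsteinNoise p n P (weibullScale K d) :=
    fun P hP => isBernsteinNoise_of_mem_Gclass hP hK hd
  have hnull : (⨆ P ∈ Gclass p n α K, ⨆ θ ∈ Theta0 p n,
      ∫ E, phiGdense p n (C₁ * (Real.sqrt ((p : ℝ) * LL n) + LL n)) (θ + E) ∂P) ≤ ε / 2 := by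
    refine Real.iSup_le (fun P => Real.iSup_le (fun hP => Real.iSup_le (fun θ =>
      Real.iSup_le (fun hθ => ?_) (by positivity)) (by positivity)) (by positivity))
      (by positivity)
    refine ((hnoise P hP).integral_phiGdense_null_le hp hn hB hscale (M := 4 / ε)
      (by rw [le_div_iff₀ hε0]; linarith) hθ).trans_eq ?_
    field_simp
    norm_num
  have halt : (⨆ P ∈ Gclass p n α K, ⨆ θ ∈ Theta1 p n s ρ,
      ∫ E, (1 - phiGdense p n (C₁ * (Real.sqrt ((p : ℝ) * LL n) + LL n)) (θ + E)) ∂P) ≤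
        ε / 2 := by
    refine Real.iSup_le (fun P => Real.iSup_le (fun hP => Real.iSup_le (fun θ =>
      Real.iSup_le (fun hθ => ?_) (by positivity)) (by positivity)) (by positivity))
      (by positivity)
    simp only [Theta1, Set.mem_iUnion, Finset.mem_Icc] at hθ
    obtain ⟨t0, ⟨ht1, ht2⟩, hθ⟩ := hθ
    obtain ⟨k, hk, hkn, hS⟩ := exists_scale_of_mem_ThetaAt ht1 ht2 hθ
    have hy : Real.sqrt p ≤ Real.sqrt (p * LL n) + LL n := by
      have := Real.sqrt_le_sqrt (le_mul_of_one_le_right hp0.le hLL)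
      linarith
    obtain ⟨hr, hbound⟩ := type_two_error_budget hε0 hε1 hC₁0 H
      (by exact_mod_cast hp : (1 : ℝ) ≤ p) hy
    refine ((hnoise P hP).integral_one_sub_phiGdense_le hp hk hkn hB (hscale k) ?_ hr
      (le_trans ?_ hS)).trans hbound
    · positivity
    · linarith
  exact (add_le_add hnull halt).trans_eq (add_halves ε)

end ChangePoint
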